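/- For each n ∈ ℕ, BΣ_{n+2} proves WR(Σ_{n+1} ∨ Π_{n+1}): every model of BΣ_{n+2} satisfies the weak regularity principle WRφ for every formula φ(x,y) that is a disjunction of a Σ_{n+1} formula and a Π_{n+1} formula, with parameters. -/

import Mathlib

namespace PaperArith

/-! ## Syntax of (two-sorted) first-order arithmetic

Terms and formulas of arithmetic in the language `{0, 1, +, ·, <}`,
with number variables and (monadic second-order) set variables both indexed
by natural numbers.  Bounded quantifiers are taken as primitives, so that the
class `Δ₀` of bounded formulas is a purely syntactic class. -/

/-- Terms of first-order arithmetic in the language `{0, 1, +, ·, <}`. -/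
inductive Term : Type
  | var : ℕ → Term
  | zero : Term
  | one : Term
  | add : Term → Term → Term
  | mul : Term → Term → Term

/-- Formulas of (two-sorted) arithmetic.  `mem t i` is the atomic formula
`t ∈ Xᵢ`; `ball x t φ` is `∀ x < t, φ` and `bex x t φ` is `∃ x < t, φ`;
`sall i φ` and `sex i φ` quantify over the set variable `Xᵢ`.
Purely first-order formulas are those avoiding `mem`, `sall`, `sex`. -/
inductive Fml : Type
  | eq : Term → Term → Fml
  | lt : Term → Term → Fml
  | mem : Term → ℕ → Fml
  | not : Fml → Fml
  | and : Fml → Fml → Fml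
  | or : Fml → Fml → Fml
  | imp : Fml → Fml → Fml
  | all : ℕ → Fml → Fml
  | ex : ℕ → Fml → Fml
  | ball : ℕ → Term → Fml → Fml
  | bex : ℕ → Term → Fml → Fml
  | sall : ℕ → Fml → Fml
  | sex : ℕ → Fml → Fml

/-- A structure for the first-order language of arithmetic. -/
structure Str : Type 1 where
  M : Type
  zero : M
  one : M
  add : M → M → M
  mul : M → M → M
  lt : M → M → Prop

/-- Value of a term under a valuation of the number variables. -/
def tval (S : Str) (v : ℕ → S.M) : Term → S.M
  | .var i => v i
  | .zero => S.zero
  | .one => S.one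
  | .add t u => S.add (tval S v t) (tval S v u)
  | .mul t u => S.mul (tval S v t) (tval S v u)

/-- Update a valuation at one variable. -/
def upd {α : Type} (v : ℕ → α) (x : ℕ) (a : α) : ℕ → α :=
  fun i => if i = x then a else v i

/-- Tarskian satisfaction over the structure `S`, with second-order universe
`X` (set quantifiers range over `X`); `v` is the valuation of number
variables, `w` the valuation of set variables. -/
def Sat (S : Str) (X : Set (Set S.M)) : (ℕ → S.M) → (ℕ → Set S.M) → Fml → Prop
  | v, _, .eq t u => tval S v t = tval S v u
  | v, _, .lt t u => S.lt (tval S v t) (tval S v u)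
  | v, w, .mem t i => tval S v t ∈ w i
  | v, w, .not φ => ¬ Sat S X v w φ
  | v, w, .and φ ψ => Sat S X v w φ ∧ Sat S X v w ψ
  | v, w, .or φ ψ => Sat S X v w φ ∨ Sat S X v w ψ
  | v, w, .imp φ ψ => Sat S X v w φ → Sat S X v w ψ
  | v, w, .all x φ => ∀ m : S.M, Sat S X (upd v x m) w φ
  | v, w, .ex x φ => ∃ m : S.M, Sat S X (upd v x m) w φ
  | v, w, .ball x t φ => ∀ m : S.M, S.lt m (tval S v t) → Sat S X (upd v x m) w φ
  | v, w, .bex x t φ => ∃ m : S.M, S.lt m (tval S v t) ∧ Sat S X (upd v x m) w φ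
  | v, w, .sall i φ => ∀ A : Set S.M, A ∈ X → Sat S X v (upd w i A) φ
  | v, w, .sex i φ => ∃ A : Set S.M, A ∈ X ∧ Sat S X v (upd w i A) φ

/-- First-order satisfaction (for purely first-order formulas the second-order
data is irrelevant). -/
def Sat0 (S : Str) (v : ℕ → S.M) (φ : Fml) : Prop :=
  Sat S ∅ v (fun _ => ∅) φ

/-! ## The arithmetic hierarchy -/

/-- `Δ₀` formulas: purely first-order, only bounded quantifiers. -/
inductive Delta0 : Fml → Prop
  | eq (t u : Term) : Delta0 (.eq t u)
  | lt (t u : Term) : Delta0 (.lt t u)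
  | not {φ : Fml} : Delta0 φ → Delta0 (.not φ)
  | and {φ ψ : Fml} : Delta0 φ → Delta0 ψ → Delta0 (.and φ ψ)
  | or {φ ψ : Fml} : Delta0 φ → Delta0 ψ → Delta0 (.or φ ψ)
  | imp {φ ψ : Fml} : Delta0 φ → Delta0 ψ → Delta0 (.imp φ ψ)
  | ball (x : ℕ) (t : Term) {φ : Fml} : Delta0 φ → Delta0 (.ball x t φ)
  | bex (x : ℕ) (t : Term) {φ : Fml} : Delta0 φ → Delta0 (.bex x t φ)

mutual
  /-- `Σₙ` formulas of the first-order arithmetic hierarchy. -/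
  inductive IsSigma : ℕ → Fml → Prop
    | delta0 {n : ℕ} {φ : Fml} : Delta0 φ → IsSigma n φ
    | ofPi {n : ℕ} {φ : Fml} : IsPi n φ → IsSigma (n + 1) φ
    | ex (x : ℕ) {n : ℕ} {φ : Fml} : IsSigma (n + 1) φ → IsSigma (n + 1) (.ex x φ)
  /-- `Πₙ` formulas of the first-order arithmetic hierarchy. -/
  inductive IsPi : ℕ → Fml → Prop
    | delta0 {n : ℕ} {φ : Fml} : Delta0 φ → IsPi n φ
    | ofSigma {n : ℕ} {φ : Fml} : IsSigma n φ → IsPi (n + 1) φ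
    | all (x : ℕ) {n : ℕ} {φ : Fml} : IsPi (n + 1) φ → IsPi (n + 1) (.all x φ)
end

/-- `Σ₀(Σₙ)`: the closure of `Σₙ` under Boolean operations and bounded
quantification. -/
inductive Sigma0Sigma (n : ℕ) : Fml → Prop
  | ofSigma {φ : Fml} : IsSigma n φ → Sigma0Sigma n φ
  | not {φ : Fml} : Sigma0Sigma n φ → Sigma0Sigma n (.not φ)
  | and {φ ψ : Fml} : Sigma0Sigma n φ → Sigma0Sigma n ψ → Sigma0Sigma n (.and φ ψ)
  | or {φ ψ : Fml} : Sigma0Sigma n φ → Sigma0Sigma n ψ → Sigma0Sigma n (.or φ ψ)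
  | imp {φ ψ : Fml} : Sigma0Sigma n φ → Sigma0Sigma n ψ → Sigma0Sigma n (.imp φ ψ)
  | ball (x : ℕ) (t : Term) {φ : Fml} : Sigma0Sigma n φ → Sigma0Sigma n (.ball x t φ)
  | bex (x : ℕ) (t : Term) {φ : Fml} : Sigma0Sigma n φ → Sigma0Sigma n (.bex x t φ)

/-- The class `Σₙ ∧ Πₙ` of conjunctions of a `Σₙ` and a `Πₙ` formula. -/
def SigmaAndPi (n : ℕ) (φ : Fml) : Prop :=
  ∃ ψ χ : Fml, IsSigma n ψ ∧ IsPi n χ ∧ φ = Fml.and ψ χ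

/-- The class `Σₙ ∨ Πₙ` of disjunctions of a `Σₙ` and a `Πₙ` formula. -/
def SigmaOrPi (n : ℕ) (φ : Fml) : Prop :=
  ∃ ψ χ : Fml, IsSigma n ψ ∧ IsPi n χ ∧ φ = Fml.or ψ χ

/-- `Δ₀⁰` formulas of second-order arithmetic: only bounded first-order
quantifiers; free set variables (set parameters) are allowed. -/
inductive Delta0SO : Fml → Prop
  | eq (t u : Term) : Delta0SO (.eq t u)
  | lt (t u : Term) : Delta0SO (.lt t u)
  | mem (t : Term) (i : ℕ) : Delta0SO (.mem t i)
  | not {φ : Fml} : Delta0SO φ → Delta0SO (.not φ)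
  | and {φ ψ : Fml} : Delta0SO φ → Delta0SO ψ → Delta0SO (.and φ ψ)
  | or {φ ψ : Fml} : Delta0SO φ → Delta0SO ψ → Delta0SO (.or φ ψ)
  | imp {φ ψ : Fml} : Delta0SO φ → Delta0SO ψ → Delta0SO (.imp φ ψ)
  | ball (x : ℕ) (t : Term) {φ : Fml} : Delta0SO φ → Delta0SO (.ball x t φ)
  | bex (x : ℕ) (t : Term) {φ : Fml} : Delta0SO φ → Delta0SO (.bex x t φ)

mutual
  /-- `Σₙ⁰` formulas of the second-order arithmetic hierarchy
  (set parameters allowed, no set quantifiers). -/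
  inductive SigmaSO : ℕ → Fml → Prop
    | delta0 {n : ℕ} {φ : Fml} : Delta0SO φ → SigmaSO n φ
    | ofPi {n : ℕ} {φ : Fml} : PiSO n φ → SigmaSO (n + 1) φ
    | ex (x : ℕ) {n : ℕ} {φ : Fml} : SigmaSO (n + 1) φ → SigmaSO (n + 1) (.ex x φ)
  /-- `Πₙ⁰` formulas of the second-order arithmetic hierarchy. -/
  inductive PiSO : ℕ → Fml → Prop
    | delta0 {n : ℕ} {φ : Fml} : Delta0SO φ → PiSO n φ
    | ofSigma {n : ℕ} {φ : Fml} : SigmaSO n φ → PiSO (n + 1) φ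
    | all (x : ℕ) {n : ℕ} {φ : Fml} : PiSO (n + 1) φ → PiSO (n + 1) (.all x φ)
end

/-! ## First-order theories -/

/-- `PA⁻`: the theory of non-negative parts of discretely ordered rings. -/
structure PAminus (S : Str) : Prop where
  add_assoc : ∀ a b c, S.add (S.add a b) c = S.add a (S.add b c)
  add_comm : ∀ a b, S.add a b = S.add b a
  mul_assoc : ∀ a b c, S.mul (S.mul a b) c = S.mul a (S.mul b c)
  mul_comm : ∀ a b, S.mul a b = S.mul b a
  distrib : ∀ a b c, S.mul a (S.add b c) = S.add (S.mul a b) (S.mul a c)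
  add_zero : ∀ a, S.add a S.zero = a
  mul_zero : ∀ a, S.mul a S.zero = S.zero
  mul_one : ∀ a, S.mul a S.one = a
  lt_irrefl : ∀ a, ¬ S.lt a a
  lt_trans : ∀ a b c, S.lt a b → S.lt b c → S.lt a c
  lt_total : ∀ a b, S.lt a b ∨ a = b ∨ S.lt b a
  add_lt_add : ∀ a b c, S.lt a b → S.lt (S.add a c) (S.add b c)
  mul_lt_mul : ∀ a b c, S.lt a b → S.lt S.zero c → S.lt (S.mul a c) (S.mul b c)
  zero_lt_one : S.lt S.zero S.one
  zero_le : ∀ a, a = S.zero ∨ S.lt S.zero a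
  discrete : ∀ a b, S.lt a b → S.add a S.one = b ∨ S.lt (S.add a S.one) b
  pred : ∀ a, S.lt S.zero a → ∃ b, S.add b S.one = a
  sub : ∀ a b, S.lt a b → ∃ c, S.add a c = b

/-- The induction scheme for the class `Γ` of formulas
(parameters are allowed via the ambient valuation `v`). -/
def IndFor (S : Str) (Γ : Fml → Prop) : Prop :=
  ∀ φ : Fml, Γ φ → ∀ (v : ℕ → S.M) (x : ℕ),
    Sat0 S (upd v x S.zero) φ →
    (∀ m, Sat0 S (upd v x m) φ → Sat0 S (upd v x (S.add m S.one)) φ) →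
    ∀ m, Sat0 S (upd v x m) φ

/-- The collection scheme for the class `Γ`:
`(∀ x < a ∃ y φ) → (∃ b ∀ x < a ∃ y < b φ)`. -/
def CollFor (S : Str) (Γ : Fml → Prop) : Prop :=
  ∀ φ : Fml, Γ φ → ∀ (v : ℕ → S.M) (x y : ℕ), x ≠ y → ∀ a : S.M,
    (∀ m, S.lt m a → ∃ k, Sat0 S (upd (upd v x m) y k) φ) →
    ∃ b, ∀ m, S.lt m a → ∃ k, S.lt k b ∧ Sat0 S (upd (upd v x m) y k) φ

/-- `IΔ₀` (over `PA⁻`). -/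
def IDelta0 (S : Str) : Prop := PAminus S ∧ IndFor S Delta0

/-- `IΣₙ` (over `PA⁻`; note `Δ₀ ⊆ Σₙ`, so this includes `IΔ₀`). -/
def ISigma (S : Str) (n : ℕ) : Prop := PAminus S ∧ IndFor S (IsSigma n)

/-- `BΣₙ`: the `Σₙ`-collection scheme, including `IΔ₀` (over `PA⁻`). -/
def BSigma (S : Str) (n : ℕ) : Prop := IDelta0 S ∧ CollFor S (IsSigma n)

/-- The weak regularity principle `WRφ` for all `φ` in the class `Γ`:
the universal closure of `(∀ x ∃ y < a φ(x,y)) → (∃ y < a ∀ b ∃ x > b φ(x,y))`.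
Here `x, y` are the two displayed variables and all other free variables of
`φ` are parameters, interpreted by the ambient valuation `v`. -/
def WRFor (S : Str) (Γ : Fml → Prop) : Prop :=
  ∀ φ : Fml, Γ φ → ∀ (v : ℕ → S.M) (x y : ℕ), x ≠ y → ∀ a : S.M,
    (∀ m, ∃ k, S.lt k a ∧ Sat0 S (upd (upd v x m) y k) φ) →
    ∃ k, S.lt k a ∧ ∀ b, ∃ m, S.lt b m ∧ Sat0 S (upd (upd v x m) y k) φ

/-! ## Second-order theories -/

/-- Second-order induction scheme for the class `Γ`, with set parameters
from the second-order universe `X`. -/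
def IndForSO (S : Str) (X : Set (Set S.M)) (Γ : Fml → Prop) : Prop :=
  ∀ φ : Fml, Γ φ → ∀ (v : ℕ → S.M) (w : ℕ → Set S.M), (∀ i, w i ∈ X) → ∀ x : ℕ,
    Sat S X (upd v x S.zero) w φ →
    (∀ m, Sat S X (upd v x m) w φ → Sat S X (upd v x (S.add m S.one)) w φ) →
    ∀ m, Sat S X (upd v x m) w φ

/-- Second-order collection scheme for the class `Γ`. -/
def CollForSO (S : Str) (X : Set (Set S.M)) (Γ : Fml → Prop) : Prop :=
  ∀ φ : Fml, Γ φ → ∀ (v : ℕ → S.M) (w : ℕ → Set S.M), (∀ i, w i ∈ X) →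
    ∀ (x y : ℕ), x ≠ y → ∀ a : S.M,
    (∀ m, S.lt m a → ∃ k, Sat S X (upd (upd v x m) y k) w φ) →
    ∃ b, ∀ m, S.lt m a → ∃ k, S.lt k b ∧ Sat S X (upd (upd v x m) y k) w φ

/-- `Δ₁⁰`-comprehension. -/
def Delta1CA (S : Str) (X : Set (Set S.M)) : Prop :=
  ∀ φ ψ : Fml, SigmaSO 1 φ → PiSO 1 ψ →
    ∀ (v : ℕ → S.M) (w : ℕ → Set S.M), (∀ i, w i ∈ X) → ∀ x : ℕ,
    (∀ m, Sat S X (upd v x m) w φ ↔ Sat S X (upd v x m) w ψ) →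
    ∃ A ∈ X, ∀ m, m ∈ A ↔ Sat S X (upd v x m) w φ

/-- `Σₙ`-comprehension for first-order formulas with parameters from `M`. -/
def SigmaCA (S : Str) (X : Set (Set S.M)) (n : ℕ) : Prop :=
  ∀ φ : Fml, IsSigma n φ → ∀ (v : ℕ → S.M) (x : ℕ),
    ∃ A ∈ X, ∀ m, m ∈ A ↔ Sat0 S (upd v x m) φ

/-- `RCA₀`. -/
def RCA0 (S : Str) (X : Set (Set S.M)) : Prop :=
  PAminus S ∧ IndForSO S X (SigmaSO 1) ∧ Delta1CA S X

/-- `Σ₁⁰`-separation; over `RCA₀` this is equivalent to weak Kőnig's lemma. -/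
def Sigma1Sep (S : Str) (X : Set (Set S.M)) : Prop :=
  ∀ φ ψ : Fml, SigmaSO 1 φ → SigmaSO 1 ψ →
    ∀ (v : ℕ → S.M) (w : ℕ → Set S.M), (∀ i, w i ∈ X) → ∀ x : ℕ,
    (∀ m, ¬ (Sat S X (upd v x m) w φ ∧ Sat S X (upd v x m) w ψ)) →
    ∃ A ∈ X, ∀ m, (Sat S X (upd v x m) w φ → m ∈ A) ∧ (m ∈ A → ¬ Sat S X (upd v x m) w ψ)

/-- `WKL₀`, rendered as `RCA₀` plus `Σ₁⁰`-separation (which is equivalent,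
over `RCA₀`, to weak Kőnig's lemma). -/
def WKL0 (S : Str) (X : Set (Set S.M)) : Prop := RCA0 S X ∧ Sigma1Sep S X

/-- `BΣₙ⁰`: the second-order `Σₙ⁰`-collection scheme (including `IΔ₀⁰`,
over `PA⁻`). -/
def BSigmaSO (S : Str) (X : Set (Set S.M)) (n : ℕ) : Prop :=
  PAminus S ∧ IndForSO S X Delta0SO ∧ CollForSO S X (SigmaSO n)

/-- `IΣₙ⁰`: the second-order `Σₙ⁰`-induction scheme, over `RCA₀`. -/
def ISigmaSO (S : Str) (X : Set (Set S.M)) (n : ℕ) : Prop :=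
  RCA0 S X ∧ IndForSO S X (SigmaSO n)

/-! ## Exponentiation and binary digits -/

/-- Satisfaction of a three-variable formula `E(x₀, x₁, x₂)` at `(a, b, c)`. -/
def ExpAt (S : Str) (E : Fml) (a b c : S.M) : Prop :=
  Sat0 S (fun i => if i = 0 then a else if i = 1 then b else c) E

/-- `E(x₀,x₁,x₂)` is a `Δ₀` definition of the (total) exponentiation function
`x₀ ^ x₁ = x₂`.  The existence of such an `E` expresses `exp`
(the totality of exponentiation). -/
structure IsExpDef (S : Str) (E : Fml) : Prop where
  delta0 : Delta0 E
  base : ∀ a, ExpAt S E a S.zero S.one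
  total : ∀ a b, ∃ c, ExpAt S E a b c
  unique : ∀ a b c c', ExpAt S E a b c → ExpAt S E a b c' → c = c'
  step : ∀ a b c, ExpAt S E a b c → ExpAt S E a (S.add b S.one) (S.mul c a)

/-- `exp`: the totality of exponentiation (via a `Δ₀` definition of its
graph). -/
def SatExp (S : Str) : Prop := ∃ E : Fml, IsExpDef S E

/-! ## Embeddings, end extensions and elementarity -/

/-- An embedding of arithmetic structures. -/
structure Emb (S K : Str) where
  j : S.M → K.M
  inj : Function.Injective j
  zero : j S.zero = K.zero
  one : j S.one = K.one
  add : ∀ a b, j (S.add a b) = K.add (j a) (j b)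
  mul : ∀ a b, j (S.mul a b) = K.mul (j a) (j b)
  lt_iff : ∀ a b, S.lt a b ↔ K.lt (j a) (j b)

/-- The extension along `e` is an end extension: every element of `K` not in
the image of `M` exceeds every element of `M`. -/
def IsEndExt {S K : Str} (e : Emb S K) : Prop :=
  ∀ b : K.M, b ∉ Set.range e.j → ∀ a : S.M, K.lt (e.j a) b

/-- The extension along `e` is proper. -/
def IsProper {S K : Str} (e : Emb S K) : Prop := ¬ Function.Surjective e.j

/-- The extension along `e` is `Σₙ`-elementary: all `Σₙ` formulas with
parameters from `M` are absolute between `M` and `K`. -/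
def SigmaElem {S K : Str} (e : Emb S K) (n : ℕ) : Prop :=
  ∀ φ : Fml, IsSigma n φ → ∀ v : ℕ → S.M,
    (Sat0 S v φ ↔ Sat0 K (fun i => e.j (v i)) φ)

/-- `K ⊨ M‑IΣₙ` (for an extension `e : M → K`): induction up to any `a ∈ M`
for `Σₙ` formulas with parameters from `K`. -/
def MISigma {S K : Str} (e : Emb S K) (n : ℕ) : Prop :=
  ∀ φ : Fml, IsSigma n φ → ∀ (v : ℕ → K.M) (x : ℕ) (a : S.M),
    Sat0 K (upd v x K.zero) φ →
    (∀ m, K.lt m (e.j a) → (Sat0 K (upd v x m) φ → Sat0 K (upd v x (K.add m K.one)) φ)) →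
    ∀ m, K.lt m (e.j a) → Sat0 K (upd v x m) φ

/-- The `x`-th binary digit of `c ∈ K` is `1`, computed via a `Δ₀` definition
`E` of exponentiation on the ground model `S` (here `x` lies under the image
of `S`): there are `x', p ∈ M` with `j x' = x`, `p = 2 ^ x'`, and `u, v ∈ K`
with `c = u·(2p) + p + v` and `v < p`. -/
def BitVia {S K : Str} (e : Emb S K) (E : Fml) (x c : K.M) : Prop :=
  ∃ x' p : S.M, e.j x' = x ∧ ExpAt S E (S.add S.one S.one) x' p ∧
    ∃ u v : K.M, K.lt v (e.j p) ∧
      c = K.add (K.add (K.mul u (K.add (e.j p) (e.j p))) (e.j p)) v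

/-! ## The second-order restricted ultrapower -/

/-- `A` is cofinal (unbounded) in `S`. -/
def Cofinal (S : Str) (A : Set S.M) : Prop := ∀ b : S.M, ∃ x ∈ A, S.lt b x

/-- The pairing term `⟨x, y⟩ = (x + y)·(x + y) + x`. -/
def pairS (S : Str) (x y : S.M) : S.M := S.add (S.mul (S.add x y) (S.add x y)) x

/-- The graph of `f : M → M`, coded as a subset of `M` via pairing. -/
def graphOf (S : Str) (f : S.M → S.M) : Set S.M := {m | ∃ x, m = pairS S x (f x)}

/-- `f` is a total function `M → M` lying in the second-order universe `X`
(its coded graph belongs to `X`).  The collection of such `f` is the class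
`ℱ` of the restricted ultrapower. -/
def FuncIn (S : Str) (X : Set (Set S.M)) (f : S.M → S.M) : Prop := graphOf S f ∈ X

/-- `U` is an ultrafilter on the Boolean algebra `X`, all of whose elements
are cofinal in `M`. -/
structure UltraOn (S : Str) (X U : Set (Set S.M)) : Prop where
  subset : U ⊆ X
  univ_mem : Set.univ ∈ U
  empty_not_mem : ∅ ∉ U
  inter_mem : ∀ A ∈ U, ∀ B ∈ U, A ∩ B ∈ U
  superset_mem : ∀ A ∈ U, ∀ B ∈ X, A ⊆ B → B ∈ U
  ultra : ∀ A ∈ X, A ∈ U ∨ Aᶜ ∈ U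
  cofinal : ∀ A ∈ U, Cofinal S A

/-- A realization of the second-order restricted ultrapower `ℱ/𝒰` of `S`
with respect to the second-order universe `X` and the ultrafilter `U`:
a structure `K` whose elements are exactly the classes `cls f hf = [f]` of
total functions `f ∈ ℱ`, where `[f] = [g]` iff `f = g` on a set in `U`, with
pointwise arithmetic operations, order decided by `U`, and the inherited
second-order membership relation `memK` serving as the second-order expansion. -/
structure RUP (S : Str) (X U : Set (Set S.M)) : Type 1 where
  K : Str
  cls : (f : S.M → S.M) → FuncIn S X f → K.M
  memK : K.M → Set S.M → Prop
  const_in : ∀ a : S.M, FuncIn S X (fun _ => a)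
  surj : ∀ b : K.M, ∃ (f : S.M → S.M) (hf : FuncIn S X f), cls f hf = b
  eq_iff : ∀ (f : S.M → S.M) (hf : FuncIn S X f) (g : S.M → S.M) (hg : FuncIn S X g),
      (cls f hf = cls g hg) ↔ {i : S.M | f i = g i} ∈ U
  lt_iff : ∀ (f : S.M → S.M) (hf : FuncIn S X f) (g : S.M → S.M) (hg : FuncIn S X g),
      K.lt (cls f hf) (cls g hg) ↔ {i : S.M | S.lt (f i) (g i)} ∈ U
  zero_eq : K.zero = cls (fun _ => S.zero) (const_in S.zero)
  one_eq : K.one = cls (fun _ => S.one) (const_in S.one)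
  add_eq : ∀ (f : S.M → S.M) (hf : FuncIn S X f) (g : S.M → S.M) (hg : FuncIn S X g)
      (h : S.M → S.M) (hh : FuncIn S X h), (∀ i, h i = S.add (f i) (g i)) →
      K.add (cls f hf) (cls g hg) = cls h hh
  mul_eq : ∀ (f : S.M → S.M) (hf : FuncIn S X f) (g : S.M → S.M) (hg : FuncIn S X g)
      (h : S.M → S.M) (hh : FuncIn S X h), (∀ i, h i = S.mul (f i) (g i)) →
      K.mul (cls f hf) (cls g hg) = cls h hh
  mem_iff : ∀ (f : S.M → S.M) (hf : FuncIn S X f) (A : Set S.M), A ∈ X →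
      (memK (cls f hf) A ↔ {i : S.M | f i ∈ A} ∈ U)

/-- The canonical embedding `M → ℱ/𝒰` via constant functions. -/
def RUP.emb {S : Str} {X U : Set (Set S.M)} (R : RUP S X U) (a : S.M) : R.K.M :=
  R.cls (fun _ => a) (R.const_in a)

/-- The subset of `ℱ/𝒰` induced by `A ⊆ M`. -/
def RUP.setImg {S : Str} {X U : Set (Set S.M)} (R : RUP S X U) (A : Set S.M) :
    Set R.K.M := {b | R.memK b A}

/-- The second-order part of the expanded ultrapower `(ℱ/𝒰, 𝒳)`:
the (injected) copy of `X`. -/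
def RUP.X2 {S : Str} {X U : Set (Set S.M)} (R : RUP S X U) : Set (Set R.K.M) :=
  (fun A => R.setImg A) '' X

end PaperArith

namespace PaperArith

/-! ## Definability over an ordered semiring, with parameters -/

section Definability

variable {M : Type}

/-- Extend a valuation by a new value for the variable `0`. -/
def cons (m : M) (e : ℕ → M) : ℕ → M
  | 0 => m
  | i + 1 => e i

/-- The substitution `σ` pushed under a quantifier. -/
def liftSubst (σ : ℕ → (ℕ → M) → M) : ℕ → (ℕ → M) → M
  | 0 => fun e => e 0
  | i + 1 => fun e => σ i fun j => e (j + 1)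

theorem liftSubst_cons (σ : ℕ → (ℕ → M) → M) (m : M) (e : ℕ → M) :
    (fun i => liftSubst σ i (cons m e)) = cons m fun i => σ i e := by
  funext i
  cases i <;> rfl

/-- The substitution that leaves out the variable `n`. -/
def skipVar (n : ℕ) : ℕ → (ℕ → M) → M := fun i e => if i < n then e i else e (i + 1)

theorem skipVar_two_cons (x y z : M) (e : ℕ → M) :
    (fun i => skipVar 2 i (cons x (cons y (cons z e)))) = cons x (cons y e) := by
  funext i
  match i with
  | 0 => simp [skipVar, cons]
  | 1 => simp [skipVar, cons]
  | i + 2 => simp [skipVar, cons]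

section Classes

variable [Add M] [Mul M]

/-- Polynomial functions of a valuation, with parameters. -/
inductive IsPoly : ((ℕ → M) → M) → Prop
  | var (i : ℕ) : IsPoly fun e => e i
  | const (c : M) : IsPoly fun _ => c
  | add {s t : (ℕ → M) → M} : IsPoly s → IsPoly t → IsPoly fun e => s e + t e
  | mul {s t : (ℕ → M) → M} : IsPoly s → IsPoly t → IsPoly fun e => s e * t e

theorem IsPoly.subst {s : (ℕ → M) → M} (hs : IsPoly s) {σ : ℕ → (ℕ → M) → M}
    (hσ : ∀ i, IsPoly (σ i)) : IsPoly fun e => s fun i => σ i e := by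
  induction hs with
  | var i => exact hσ i
  | const c => exact .const c
  | add _ _ h₁ h₂ => exact h₁.add h₂
  | mul _ _ h₁ h₂ => exact h₁.mul h₂

theorem isPoly_liftSubst {σ : ℕ → (ℕ → M) → M} (hσ : ∀ i, IsPoly (σ i)) (i : ℕ) :
    IsPoly (liftSubst σ i) := by
  cases i with
  | zero => exact .var 0
  | succ i => exact (hσ i).subst fun j => .var (j + 1)

theorem isPoly_skipVar (n i : ℕ) : IsPoly (skipVar (M := M) n i) := by
  unfold skipVar
  split_ifs
  exacts [.var i, .var (i + 1)]

variable [LT M]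

/-- Predicates definable by a bounded formula with parameters. -/
inductive DefBdd : ((ℕ → M) → Prop) → Prop
  | eq {s t : (ℕ → M) → M} : IsPoly s → IsPoly t → DefBdd fun e => s e = t e
  | lt {s t : (ℕ → M) → M} : IsPoly s → IsPoly t → DefBdd fun e => s e < t e
  | not {P : (ℕ → M) → Prop} : DefBdd P → DefBdd fun e => ¬ P e
  | and {P Q : (ℕ → M) → Prop} : DefBdd P → DefBdd Q → DefBdd fun e => P e ∧ Q e
  | ball {t : (ℕ → M) → M} {P : (ℕ → M) → Prop} : IsPoly t → DefBdd P →
      DefBdd fun e => ∀ m, m < t e → P (cons m e)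

/-- Predicates definable with `j` alternating unbounded quantifiers, the outermost one being
existential, in front of a bounded formula with parameters. -/
def DefSigma : ℕ → ((ℕ → M) → Prop) → Prop
  | 0, P => DefBdd P
  | j + 1, P => ∃ Q, DefSigma j Q ∧ ∀ e, P e ↔ ∃ m, ¬ Q (cons m e)

theorem DefBdd.congr {P Q : (ℕ → M) → Prop} (hP : DefBdd P) (h : ∀ e, P e ↔ Q e) :
    DefBdd Q := by
  have : P = Q := funext fun e => propext (h e)
  exact this ▸ hP

theorem DefSigma.congr {j : ℕ} {P Q : (ℕ → M) → Prop} (hP : DefSigma j P)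
    (h : ∀ e, P e ↔ Q e) : DefSigma j Q := by
  have : P = Q := funext fun e => propext (h e)
  exact this ▸ hP

theorem DefBdd.or {P Q : (ℕ → M) → Prop} (hP : DefBdd P) (hQ : DefBdd Q) :
    DefBdd fun e => P e ∨ Q e :=
  (hP.not.and hQ.not).not.congr fun e => by tauto

theorem DefBdd.imp {P Q : (ℕ → M) → Prop} (hP : DefBdd P) (hQ : DefBdd Q) :
    DefBdd fun e => P e → Q e :=
  (hP.and hQ.not).not.congr fun e => by tauto

theorem DefBdd.iff {P Q : (ℕ → M) → Prop} (hP : DefBdd P) (hQ : DefBdd Q) :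
    DefBdd fun e => P e ↔ Q e :=
  ((hP.imp hQ).and (hQ.imp hP)).congr fun e => by tauto

theorem DefBdd.bex {t : (ℕ → M) → M} {P : (ℕ → M) → Prop} (ht : IsPoly t) (hP : DefBdd P) :
    DefBdd fun e => ∃ m, m < t e ∧ P (cons m e) :=
  (DefBdd.ball ht hP.not).not.congr fun e => by push Not; rfl

theorem DefBdd.prop (p : Prop) : DefBdd fun _ : ℕ → M => p := by
  by_cases h : p
  · exact (DefBdd.eq (.var 0) (.var 0)).congr fun e => by simp [h]
  · exact (DefBdd.eq (.var 0) (.var 0)).not.congr fun e => by simp [h]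

theorem DefBdd.subst {P : (ℕ → M) → Prop} (hP : DefBdd P) :
    ∀ {σ : ℕ → (ℕ → M) → M}, (∀ i, IsPoly (σ i)) → DefBdd fun e => P fun i => σ i e := by
  induction hP with
  | eq hs ht => exact fun hσ => .eq (hs.subst hσ) (ht.subst hσ)
  | lt hs ht => exact fun hσ => .lt (hs.subst hσ) (ht.subst hσ)
  | not _ ih => exact fun hσ => (ih hσ).not
  | and _ _ ih₁ ih₂ => exact fun hσ => (ih₁ hσ).and (ih₂ hσ)
  | ball ht _ ih =>
    intro σ hσ
    refine (DefBdd.ball (ht.subst hσ) (ih (isPoly_liftSubst hσ))).congr fun e => ?_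
    simp only [liftSubst_cons]

theorem DefSigma.subst {j : ℕ} : ∀ {P : (ℕ → M) → Prop}, DefSigma j P →
    ∀ {σ : ℕ → (ℕ → M) → M}, (∀ i, IsPoly (σ i)) → DefSigma j fun e => P fun i => σ i e := by
  induction j with
  | zero => exact fun hP _ hσ => DefBdd.subst hP hσ
  | succ j ih =>
    rintro P ⟨Q, hQ, h⟩ σ hσ
    refine ⟨_, ih hQ (isPoly_liftSubst hσ), fun e => ?_⟩
    simp only [liftSubst_cons, h]

theorem DefSigma.of_pi {j : ℕ} {P : (ℕ → M) → Prop} (hP : DefSigma j fun e => ¬ P e) :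
    DefSigma (j + 1) P :=
  ⟨_, hP.subst fun i => .var (i + 1), fun e => ⟨fun h => ⟨e 0, not_not_intro h⟩,
    fun ⟨_, h⟩ => not_not.1 h⟩⟩

theorem DefSigma.succ {j : ℕ} : ∀ {P : (ℕ → M) → Prop}, DefSigma j P → DefSigma (j + 1) P := by
  induction j with
  | zero => exact fun hP => .of_pi (DefBdd.not hP)
  | succ j ih =>
    rintro P ⟨Q, hQ, h⟩
    exact ⟨Q, ih hQ, h⟩

theorem DefSigma.mono {i j : ℕ} (hij : i ≤ j) {P : (ℕ → M) → Prop} (hP : DefSigma i P) :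
    DefSigma j P :=
  Nat.le_induction hP (fun _ _ h => h.succ) j hij

theorem DefBdd.sigma {P : (ℕ → M) → Prop} (hP : DefBdd P) (j : ℕ) : DefSigma j P :=
  DefSigma.mono (i := 0) (Nat.zero_le j) hP

end Classes

/-- Discretely ordered semirings with bounded induction and `Σₖ`-collection, in terms of
definable predicates. -/
structure CollModel (M : Type) [CommSemiring M] [LinearOrder M] (k : ℕ) : Prop where
  succ_le : ∀ a b : M, a < b → a + 1 ≤ b
  ind : ∀ P : (ℕ → M) → Prop, DefBdd P → ∀ e, P (cons 0 e) →
    (∀ m, P (cons m e) → P (cons (m + 1) e)) → ∀ m, P (cons m e)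
  coll : ∀ P : (ℕ → M) → Prop, DefSigma k P → ∀ (a : M) (e : ℕ → M),
    (∀ m, m < a → ∃ z, P (cons z (cons m e))) →
      ∃ b, ∀ m, m < a → ∃ z, z < b ∧ P (cons z (cons m e))

section Closure

variable [CommSemiring M] [LinearOrder M] [IsStrictOrderedRing M] {k : ℕ}

theorem exists_gt_both (a b : M) : ∃ c, a < c ∧ b < c :=
  ⟨max a b + 1, lt_of_le_of_lt (le_max_left a b) (lt_add_one _),
    lt_of_le_of_lt (le_max_right a b) (lt_add_one _)⟩

/-- Closure properties of a class of predicates on valuations. -/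
structure BddClosed (C : ((ℕ → M) → Prop) → Prop) : Prop where
  and : ∀ {P Q}, C P → C Q → C fun e => P e ∧ Q e
  or : ∀ {P Q}, C P → C Q → C fun e => P e ∨ Q e
  ball : ∀ {t P}, IsPoly t → C P → C fun e => ∀ m, m < t e → P (cons m e)
  bex : ∀ {t P}, IsPoly t → C P → C fun e => ∃ m, m < t e ∧ P (cons m e)

theorem DefSigma.ex_of_closed {j : ℕ} (hj : BddClosed (M := M) (DefSigma j))
    {P : (ℕ → M) → Prop} (hP : DefSigma (j + 1) P) :
    DefSigma (j + 1) fun e => ∃ m, P (cons m e) := by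
  obtain ⟨Q, hQ, h⟩ := hP
  refine ⟨_, hj.ball (.var 0) (hj.ball (.var 1) (hQ.subst (isPoly_skipVar 2))), fun e => ?_⟩
  simp only [skipVar_two_cons, h, cons]
  push Not
  constructor
  · rintro ⟨m, z, hz⟩
    obtain ⟨u, hm, hz'⟩ := exists_gt_both m z
    exact ⟨u, m, hm, z, hz', hz⟩
  · rintro ⟨u, m, -, z, -, hz⟩
    exact ⟨m, z, hz⟩

theorem CollModel.bddClosed (hM : CollModel M k) {j : ℕ} (hjk : j ≤ k) :
    BddClosed (M := M) (DefSigma j) := by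
  induction j with
  | zero => exact ⟨.and, .or, .ball, .bex⟩
  | succ j ih =>
    have hj := ih (by omega)
    have hand : ∀ {P Q : (ℕ → M) → Prop}, DefSigma (j + 1) P → DefSigma (j + 1) Q →
        DefSigma (j + 1) fun e => P e ∧ Q e := by
      rintro P Q ⟨P₀, hP₀, hP⟩ ⟨Q₀, hQ₀, hQ⟩
      let σ : ℕ → ℕ → (ℕ → M) → M := fun n i => match i with
        | 0 => fun e => e n
        | i + 1 => fun e => e (i + 3)
      have hσ : ∀ n i, IsPoly (σ n i)
        | n, 0 => .var n
        | n, i + 1 => .var (i + 3)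
      have hσ₀ : ∀ z m u e, (fun i => σ 0 i (cons z (cons m (cons u e)))) = cons z e := by
        intro z m u e
        funext i
        cases i <;> rfl
      have hσ₁ : ∀ z m u e, (fun i => σ 1 i (cons z (cons m (cons u e)))) = cons m e := by
        intro z m u e
        funext i
        cases i <;> rfl
      refine ⟨_, hj.ball (.var 0) (hj.ball (.var 1)
        (hj.or (hP₀.subst (hσ 1)) (hQ₀.subst (hσ 0)))), fun e => ?_⟩
      simp only [hσ₀, hσ₁, hP, hQ, cons]
      push Not
      constructor
      · rintro ⟨⟨m, hm⟩, z, hz⟩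
        obtain ⟨u, hmu, hzu⟩ := exists_gt_both m z
        exact ⟨u, m, hmu, z, hzu, hm, hz⟩
      · rintro ⟨u, m, -, z, -, hm, hz⟩
        exact ⟨⟨m, hm⟩, z, hz⟩
    refine ⟨hand, ?_, ?_, ?_⟩
    · rintro P Q ⟨P₀, hP₀, hP⟩ ⟨Q₀, hQ₀, hQ⟩
      refine ⟨_, hj.and hP₀ hQ₀, fun e => ?_⟩
      simp only [hP, hQ, not_and_or, exists_or]
    · rintro t P ht ⟨Q, hQ, h⟩
      refine ⟨_, hj.bex (ht.subst fun i => .var (i + 1))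
        (hj.ball (.var 1) (hQ.subst (isPoly_skipVar 2))), fun e => ?_⟩
      simp only [skipVar_two_cons, h, cons]
      push Not
      constructor
      · intro he
        exact hM.coll (fun e => ¬ Q e)
          ((DefSigma.of_pi (by simpa using hQ)).mono hjk) (t e) e he
      · rintro ⟨b, hb⟩ m hm
        obtain ⟨z, -, hz⟩ := hb m hm
        exact ⟨z, hz⟩
    · intro t P ht hP
      exact DefSigma.ex_of_closed hj
        (hand ((DefBdd.lt (.var 0) (ht.subst fun i => .var (i + 1))).sigma _) hP)

theorem CollModel.ex (hM : CollModel M k) {j : ℕ} (hj : j + 1 ≤ k) {P : (ℕ → M) → Prop}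
    (hP : DefSigma (j + 1) P) : DefSigma (j + 1) fun e => ∃ m, P (cons m e) :=
  DefSigma.ex_of_closed (hM.bddClosed (by omega)) hP

end Closure

section Bounding

set_option linter.unusedSectionVars false

variable [CommSemiring M] [LinearOrder M] [IsStrictOrderedRing M] [CanonicallyOrderedAdd M]
  {k : ℕ}

/-- The first `N` variables are below `a`, the other ones vanish. -/
def InBox (N : ℕ) (a : M) (e : ℕ → M) : Prop :=
  (∀ i < N, e i < a) ∧ ∀ i, N ≤ i → e i = 0

theorem inBox_cons {N : ℕ} {a x : M} {e : ℕ → M} :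
    InBox (N + 1) a (cons x e) ↔ x < a ∧ InBox N a e := by
  constructor
  · exact fun h => ⟨h.1 0 (by omega), fun i hi => h.1 (i + 1) (by omega),
      fun i hi => h.2 (i + 1) (by omega)⟩
  · rintro ⟨hx, h₁, h₂⟩
    refine ⟨fun i hi => ?_, fun i hi => ?_⟩
    · cases i with
      | zero => exact hx
      | succ i => exact h₁ i (by omega)
    · cases i with
      | zero => omega
      | succ i => exact h₂ i (by omega)

theorem cons_head_tail (e : ℕ → M) : cons (e 0) (fun i => e (i + 1)) = e := by
  funext i
  cases i <;> rfl

theorem InBox.mono {N : ℕ} {a b : M} (hab : a ≤ b) {e : ℕ → M} (h : InBox N a e) :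
    InBox N b e :=
  ⟨fun i hi => (h.1 i hi).trans_le hab, h.2⟩

/-- Collection for tuples of bounded variables. -/
theorem CollModel.coll_box (hM : CollModel M k) (N : ℕ) (a : M) :
    ∀ {P : (ℕ → M) → Prop}, DefSigma k P → (∀ e, InBox N a e → ∃ m, P (cons m e)) →
      ∃ b, ∀ e, InBox N a e → ∃ m, m < b ∧ P (cons m e) := by
  induction N with
  | zero =>
    intro P _ h
    have hbox : ∀ e : ℕ → M, InBox 0 a e → e = fun _ => 0 :=
      fun e he => funext fun i => he.2 i (Nat.zero_le i)
    obtain ⟨m, hm⟩ := h (fun _ => 0) ⟨fun i hi => by omega, fun _ _ => rfl⟩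
    exact ⟨m + 1, fun e he => ⟨m, lt_add_one m, hbox e he ▸ hm⟩⟩
  | succ N ih =>
    intro P hP h
    have hk := hM.bddClosed le_rfl
    obtain ⟨b, hb⟩ := ih (hk.ball (.const a) (hk.bex (.var 1) (hP.subst (isPoly_skipVar 2))))
      fun e he => by
        simp only [skipVar_two_cons]
        exact hM.coll P hP a e fun x hx => h _ (inBox_cons.2 ⟨hx, he⟩)
    refine ⟨b, fun e he => ?_⟩
    rw [← cons_head_tail e] at he ⊢
    obtain ⟨hx, he⟩ := inBox_cons.1 he
    obtain ⟨c, hc, hc'⟩ := hb _ he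
    obtain ⟨m, hm, hPm⟩ := hc' _ hx
    rw [skipVar_two_cons] at hPm
    exact ⟨m, lt_trans hm hc, hPm⟩

/-- Below any bound, every predicate of low complexity is definable by a bounded formula. -/
theorem CollModel.exists_defBdd_inBox (hM : CollModel M k) {j : ℕ} (hj : j + 1 ≤ k) (N : ℕ)
    (a : M) {P : (ℕ → M) → Prop} (hP : DefSigma j P) :
    ∃ Q, DefBdd Q ∧ ∀ e, InBox N a e → (P e ↔ Q e) := by
  induction j generalizing N a P with
  | zero => exact ⟨P, hP, fun _ _ => Iff.rfl⟩
  | succ j ih =>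
    have hcompl : DefSigma (j + 1 + 1) fun e => ¬ P e := DefSigma.of_pi (by simpa using hP)
    obtain ⟨Q, hQ, h⟩ := hP
    have hQ' : DefSigma (j + 1 + 1) fun e => ¬ Q e := (DefSigma.of_pi (by simpa using hQ)).succ
    obtain ⟨b, hb⟩ := hM.coll_box N a
      (((hM.bddClosed hj).or hQ' (hcompl.subst fun i => .var (i + 1))).mono hj) fun e _ => by
        by_cases hPe : P e
        · obtain ⟨m, hm⟩ := (h e).1 hPe
          exact ⟨m, Or.inl hm⟩
        · exact ⟨0, Or.inr hPe⟩
    obtain ⟨R, hR, hQR⟩ := ih (by omega) (N + 1) (max a b) hQ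
    refine ⟨_, DefBdd.bex (.const b) hR.not, fun e he => ?_⟩
    have key : ∀ m, m < b → (Q (cons m e) ↔ R (cons m e)) := fun m hm =>
      hQR _ (inBox_cons.2 ⟨lt_max_of_lt_right hm, he.mono (le_max_left _ _)⟩)
    constructor
    · intro hPe
      obtain ⟨m, hm, hQm | hPm⟩ := hb e he
      · exact ⟨m, hm, mt (key m hm).2 hQm⟩
      · exact absurd hPe hPm
    · rintro ⟨m, hm, hRm⟩
      exact (h e).2 ⟨m, mt (key m hm).1 hRm⟩

/-- Induction for properties that are definable by bounded formulas below any bound. -/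
theorem CollModel.induction_of_local (hM : CollModel M k) {A : M → Prop}
    (hA : ∀ a, ∃ Q, DefBdd Q ∧ ∀ x, x < a → (A x ↔ Q (cons x fun _ => 0)))
    (zero : A 0) (succ : ∀ x, A x → A (x + 1)) (x : M) : A x := by
  obtain ⟨Q, hQ, h⟩ := hA (x + 1)
  refine (h x (lt_add_one x)).2 (hM.ind _
    ((DefBdd.lt (.var 0) (.const (x + 1))).imp hQ) (fun _ => 0) ?_ ?_ x (lt_add_one x))
  · exact fun h₀ => (h 0 h₀).1 zero
  · intro m ih hm
    have hm' := lt_trans (lt_add_one m) hm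
    exact (h _ hm).1 (succ m ((h m hm').2 (ih hm')))

theorem CollModel.exists_local (hM : CollModel M k) {j : ℕ} (hj : j + 1 ≤ k) {A : M → Prop}
    (hA : DefSigma j fun e => A (e 0)) (a : M) :
    ∃ Q, DefBdd Q ∧ ∀ x, x < a → (A x ↔ Q (cons x fun _ => 0)) := by
  obtain ⟨Q, hQ, h⟩ := hM.exists_defBdd_inBox hj 1 a hA
  exact ⟨Q, hQ, fun x hx => h _ (inBox_cons.2 ⟨hx, fun i hi => by omega, fun _ _ => rfl⟩)⟩

theorem CollModel.induction (hM : CollModel M k) {j : ℕ} (hj : j + 1 ≤ k) {A : M → Prop}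
    (hA : DefSigma j fun e => A (e 0)) (zero : A 0) (succ : ∀ x, A x → A (x + 1)) (x : M) :
    A x :=
  hM.induction_of_local (hM.exists_local hj hA) zero succ x

theorem CollModel.induction_pi (hM : CollModel M k) {j : ℕ} (hj : j + 1 ≤ k) {A : M → Prop}
    (hA : DefSigma j fun e => ¬ A (e 0)) (zero : A 0) (succ : ∀ x, A x → A (x + 1)) (x : M) :
    A x := by
  refine hM.induction_of_local (fun a => ?_) zero succ x
  obtain ⟨Q, hQ, h⟩ := hM.exists_local (A := fun x => ¬ A x) hj hA a
  exact ⟨_, hQ.not, fun x hx => by rw [← h x hx, not_not]⟩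

theorem CollModel.le_of_lt_succ (hM : CollModel M k) {a b : M} (h : a < b + 1) : a ≤ b :=
  not_lt.1 fun hba => (hM.succ_le b a hba).not_gt h

/-- The least number principle for bounded formulas. -/
theorem CollModel.exists_least (hM : CollModel M k) {A : M → Prop}
    (hA : DefBdd fun e => A (e 0)) (h : ∃ x, A x) : ∃ x, A x ∧ ∀ y, y < x → ¬ A y := by
  by_contra! hno
  have key : ∀ x, ∀ y, y < x → ¬ A y := fun x => hM.ind _
    (DefBdd.ball (.var 0) hA.not) (fun _ => 0) (fun y hy => absurd hy not_lt_zero)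
    (fun m ih y hy hAy => by
      rcases (hM.le_of_lt_succ hy).lt_or_eq with hlt | rfl
      · exact ih y hlt hAy
      · obtain ⟨z, hz, hAz⟩ := hno y hAy
        exact ih z hz hAz) x
  obtain ⟨x, hx⟩ := h
  exact key (x + 1) x (lt_add_one x) hx

end Bounding

section Coding

set_option linter.unusedSectionVars false

variable [CommSemiring M] [LinearOrder M] [IsStrictOrderedRing M] [CanonicallyOrderedAdd M]
  {k : ℕ}

theorem dvd_of_dvd_add_of_dvd_left {a b c : M} (h : a ∣ b + c) (hb : a ∣ b) : a ∣ c := by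
  obtain ⟨x, hx⟩ := h
  obtain ⟨y, rfl⟩ := hb
  rcases le_total y x with hyx | hxy
  · obtain ⟨z, rfl⟩ := exists_add_of_le hyx
    exact ⟨z, add_left_cancel (hx.trans (mul_add a y z))⟩
  · obtain ⟨z, rfl⟩ := exists_add_of_le hxy
    have : a * z + c = 0 :=
      add_left_cancel (a := a * x) (by rw [add_zero, ← add_assoc, ← mul_add, hx])
    rw [(add_eq_zero.1 this).2]
    exact dvd_zero a

/-- The number `c` codes, relative to the modulus `m`, the set of all `i` with
`1 + (i + 1) m ∣ c`. -/
def InCode (m c i : M) : Prop := 1 + (i + 1) * m ∣ c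

theorem inCode_of_inCode_mul {m i j d n : M} (hij : i ≠ j) (hi : i < n) (hj : j < n)
    (hm : ∀ l, l < n → l + 1 ∣ m) (hpred : ∀ l : M, 0 < l → ∃ l', l = l' + 1)
    (h : InCode m ((1 + (j + 1) * m) * d) i) : InCode m d i := by
  unfold InCode at *
  have hdvd : ∀ l, 0 < l → l ≤ i ∨ l ≤ j → l ∣ m := fun l hl hlij => by
    obtain ⟨l', rfl⟩ := hpred l hl
    refine hm l' ((lt_add_one l').trans_le ?_)
    exact hlij.elim (fun h => h.trans hi.le) fun h => h.trans hj.le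
  obtain ⟨l, hl, hlm⟩ : ∃ l, l ∣ m ∧ 1 + (i + 1) * m ∣ l * m * d := by
    rcases lt_or_gt_of_ne hij with hlt | hlt
    · obtain ⟨l, rfl⟩ := exists_add_of_le hlt.le
      refine ⟨l, hdvd l ?_ (Or.inr le_add_self), ?_⟩
      · exact pos_iff_ne_zero.2 fun h => by simp [h] at hlt
      · refine dvd_of_dvd_add_of_dvd_left (b := (1 + (i + 1) * m) * d) ?_ (Dvd.intro _ rfl)
        convert h using 1
        ring
    · obtain ⟨l, rfl⟩ := exists_add_of_le hlt.le
      refine ⟨l, hdvd l ?_ (Or.inl le_add_self), ?_⟩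
      · exact pos_iff_ne_zero.2 fun h => by simp [h] at hlt
      · refine dvd_of_dvd_add_of_dvd_left (b := (1 + (j + 1) * m) * d) ?_ h
        have : (1 + (j + 1) * m) * d + l * m * d = (1 + (j + l + 1) * m) * d := by ring
        rw [this]
        exact Dvd.intro _ rfl
  obtain ⟨r, rfl⟩ := hl
  set q := 1 + (i + 1) * (l * r) with hq
  have h₁ : q ∣ (i + 1) * (i + 1) * r * (l * (l * r) * d) := hlm.mul_left _
  refine dvd_of_dvd_add_of_dvd_left (b := q * (q * d)) ?_ (Dvd.intro _ rfl)
  have h₂ : q * (q * d) + d = (i + 1) * (i + 1) * r * (l * (l * r) * d) + q * (2 * d) := by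
    rw [hq]
    ring
  rw [h₂]
  exact dvd_add h₁ (Dvd.intro _ rfl)

theorem CollModel.defBdd_dvd (hM : CollModel M k) {s t : (ℕ → M) → M} (hs : IsPoly s)
    (ht : IsPoly t) : DefBdd fun e => s e ∣ t e := by
  refine (DefBdd.bex (ht.add (.const 1)) (DefBdd.eq (ht.subst fun i => .var (i + 1))
    ((hs.subst fun i => .var (i + 1)).mul (.var 0)))).congr fun e => ?_
  simp only [cons]
  refine ⟨fun ⟨z, _, hz⟩ => ⟨z, hz⟩, fun ⟨z, hz⟩ => ?_⟩
  rcases eq_or_ne (s e) 0 with h₀ | h₀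
  · exact ⟨0, by positivity, by simpa [h₀] using hz⟩
  · have h₁ : 1 ≤ s e := by simpa using hM.succ_le 0 _ (pos_iff_ne_zero.2 h₀)
    exact ⟨z, (le_mul_of_one_le_left (zero_le) h₁).trans_lt (hz ▸ lt_add_one _), hz⟩

theorem CollModel.defBdd_inCode (hM : CollModel M k) {s t u : (ℕ → M) → M} (hs : IsPoly s)
    (ht : IsPoly t) (hu : IsPoly u) : DefBdd fun e => InCode (s e) (t e) (u e) :=
  hM.defBdd_dvd ((IsPoly.const 1).add ((hu.add (.const 1)).mul hs)) ht

theorem CollModel.exists_common_multiple (hM : CollModel M k) (hk : 2 ≤ k) {t : M → M}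
    (ht : IsPoly fun e => t (e 0)) (hpos : ∀ i, 0 < t i) (n : M) :
    ∃ w, 0 < w ∧ ∀ i, i < n → t i ∣ w := by
  refine hM.induction (j := 1) hk (A := fun n => ∃ w, 0 < w ∧ ∀ i, i < n → t i ∣ w)
    ⟨_, ((DefBdd.lt (.const 0) (.var 0)).and (DefBdd.ball (.var 1)
      (hM.defBdd_dvd ht (.var 1)))).not, fun e => ?_⟩ ?_ ?_ n
  · simp only [not_not]
    rfl
  · exact ⟨1, one_pos, fun i hi => absurd hi not_lt_zero⟩
  · rintro n ⟨w, hw, h⟩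
    refine ⟨w * t n, mul_pos hw (hpos n), fun i hi => ?_⟩
    rcases (hM.le_of_lt_succ hi).lt_or_eq with hlt | rfl
    · exact (h i hlt).mul_right _
    · exact Dvd.intro_left _ rfl

/-- Bounded comprehension: below any bound, every set defined by a bounded formula has a code,
with a uniform bound on the codes. -/
theorem CollModel.exists_code (hM : CollModel M k) (hk : 2 ≤ k) (n : M) :
    ∃ m w : M, ∀ A : M → Prop, DefBdd (fun e => A (e 0)) →
      ∃ c, c ≤ w ∧ ∀ i, i < n → (InCode m c i ↔ A i) := by
  obtain ⟨m, hm₀, hm⟩ := hM.exists_common_multiple hk (t := fun i => i + 1)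
    ((IsPoly.var 0).add (.const 1)) (fun i => by positivity) n
  obtain ⟨w, hw₀, hw⟩ := hM.exists_common_multiple hk (t := fun i => 1 + (i + 1) * m)
    ((IsPoly.const 1).add (((IsPoly.var 0).add (.const 1)).mul (.const m)))
    (fun i => by positivity) n
  refine ⟨m, w, fun A hA => ?_⟩
  obtain ⟨c, ⟨hc₀, hc⟩, hmin⟩ := hM.exists_least
    (A := fun c => 0 < c ∧ ∀ i, i < n → A i → InCode m c i)
    ((DefBdd.lt (.const 0) (.var 0)).and (DefBdd.ball (.const n)
      (hA.imp (hM.defBdd_inCode (.const m) (.var 1) (.var 0)))))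
    ⟨w, hw₀, fun i hi _ => hw i hi⟩
  refine ⟨c, not_lt.1 fun hwc => hmin w hwc ⟨hw₀, fun i hi _ => hw i hi⟩,
    fun i hi => ⟨fun hci => by_contra fun hAi => ?_, hc i hi⟩⟩
  obtain ⟨d, rfl⟩ := hci
  have hd₀ : 0 < d := pos_iff_ne_zero.2 fun h => by simp [h] at hc₀
  have hq : 1 < 1 + (i + 1) * m := lt_add_of_pos_right _ (by positivity)
  refine hmin d (lt_mul_of_one_lt_left hd₀ hq) ⟨hd₀, fun j hj hAj => ?_⟩
  refine inCode_of_inCode_mul (by rintro rfl; exact hAi hAj) hj hi hm (fun l hl => ?_)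
    (hc j hj hAj)
  obtain ⟨l', hl'⟩ := exists_add_of_le (hM.succ_le 0 l hl)
  exact ⟨l', by rw [hl']; ring⟩

end Coding

section WeakRegularity

set_option linter.unusedSectionVars false

variable [CommSemiring M] [LinearOrder M] [IsStrictOrderedRing M] [CanonicallyOrderedAdd M]
  {k n : ℕ} {χ : M → M → Prop} {a s : M}

/-- Every `x > s` has a solution `y < a` of `χ x y` such that `b * a + y` avoids `F` for all
`b < x`.  An element `b * a + y` of `F` thus forbids the value `y` beyond `b`. -/
def Consistent (χ : M → M → Prop) (a s : M) (F : M → Prop) : Prop :=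
  ∀ x, s < x → ∃ y, y < a ∧ χ x y ∧ ∀ b, b < x → ¬ F (b * a + y)

theorem Consistent.mono {F G : M → Prop} (h : Consistent χ a s F) (hGF : ∀ l, G l → F l) :
    Consistent χ a s G := fun x hx =>
  let ⟨y, hy, hxy, hb⟩ := h x hx
  ⟨y, hy, hxy, fun b hbx hG => hb b hbx (hGF _ hG)⟩

/-- The number `i` can be consistently added to the part below `i` of the set coded by `c`. -/
def Extends (χ : M → M → Prop) (a s m c i : M) : Prop :=
  Consistent χ a s fun l => (l < i ∧ InCode m c l) ∨ l = i

theorem Extends.congr {m c m' c' i : M} (h : ∀ l, l < i → (InCode m c l ↔ InCode m' c' l)) :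
    Extends χ a s m c i ↔ Extends χ a s m' c' i := by
  constructor <;> refine fun hext => Consistent.mono hext fun l hl => hl.imp_left fun hl => ?_
  · exact ⟨hl.1, (h l hl.1).2 hl.2⟩
  · exact ⟨hl.1, (h l hl.1).1 hl.2⟩

/-- Below `p`, the number `c` codes the set obtained by greedily adding every number that can be
consistently added. -/
def IsGreedy (χ : M → M → Prop) (a s m c p : M) : Prop :=
  ∀ i, i < p → (InCode m c i ↔ Extends χ a s m c i)

theorem CollModel.defSigma_not_consistent (hM : CollModel M k) (hk : n + 2 ≤ k)
    (hχ : DefSigma (n + 1) fun e => ¬ χ (e 1) (e 0)) {F : (ℕ → M) → Prop} (hF : DefBdd F) :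
    DefSigma (n + 1) fun e => ¬ Consistent χ a s fun i => F (cons i e) := by
  have hn := hM.bddClosed (j := n + 1) (by omega)
  let σ : ℕ → (ℕ → M) → M := fun i => match i with
    | 0 => fun e => e 0 * a + e 1
    | i + 1 => fun e => e (i + 3)
  have hσ : ∀ i, IsPoly (σ i)
    | 0 => ((IsPoly.var 0).mul (.const a)).add (.var 1)
    | i + 1 => .var (i + 3)
  have hσe : ∀ b y x e, (fun i => σ i (cons b (cons y (cons x e)))) = cons (b * a + y) e := by
    intro b y x e
    funext i
    cases i <;> rfl
  refine (hM.ex (by omega) (hn.and ((DefBdd.lt (.const s) (.var 0)).sigma _)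
    (hn.ball (.const a) (hn.or hχ
      ((DefBdd.bex (.var 1) (hF.subst hσ)).sigma _))))).congr fun e => ?_
  simp only [hσe, cons, Consistent]
  push Not
  simp only [imp_iff_not_or]

theorem CollModel.defSigma_not_extends (hM : CollModel M k) (hk : n + 2 ≤ k)
    (hχ : DefSigma (n + 1) fun e => ¬ χ (e 1) (e 0)) {t u v : (ℕ → M) → M} (ht : IsPoly t)
    (hu : IsPoly u) (hv : IsPoly v) :
    DefSigma (n + 1) fun e => ¬ Extends χ a s (t e) (u e) (v e) := by
  have hv' := hv.subst fun i => IsPoly.var (i + 1)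
  exact hM.defSigma_not_consistent hk hχ (((DefBdd.lt (.var 0) hv').and
    (hM.defBdd_inCode (ht.subst fun i => .var (i + 1)) (hu.subst fun i => .var (i + 1))
      (.var 0))).or (.eq (.var 0) hv'))

theorem CollModel.defSigma_isGreedy (hM : CollModel M k) (hk : n + 2 ≤ k)
    (hχ : DefSigma (n + 1) fun e => ¬ χ (e 1) (e 0)) {t u v : (ℕ → M) → M} (ht : IsPoly t)
    (hu : IsPoly u) (hv : IsPoly v) :
    DefSigma (n + 2) fun e => IsGreedy χ a s (t e) (u e) (v e) := by
  have hn := hM.bddClosed hk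
  have ht' := ht.subst fun i => IsPoly.var (i + 1)
  have hu' := hu.subst fun i => IsPoly.var (i + 1)
  have hext := hM.defSigma_not_extends (a := a) (s := s) hk hχ ht' hu' (.var 0)
  have hcode := hM.defBdd_inCode ht' hu' (.var 0)
  refine (hn.ball hv (hn.or (hn.and (hcode.sigma _) (DefSigma.of_pi hext))
    (hn.and (hcode.not.sigma _) hext.succ))).congr fun e => ?_
  exact forall_congr' fun i => imp_congr_right fun _ => iff_iff_and_or_not_and_not.symm

theorem CollModel.consistent_of_isGreedy (hM : CollModel M k) (hk : n + 2 ≤ k)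
    (hχ : DefSigma (n + 1) fun e => ¬ χ (e 1) (e 0)) (h : ∀ x, s < x → ∃ y, y < a ∧ χ x y)
    {m c p : M} (hc : IsGreedy χ a s m c p) :
    Consistent χ a s fun l => l < p ∧ InCode m c l := by
  have hn := hM.bddClosed (j := n + 1) (by omega)
  refine hM.induction_pi (j := n + 1) hk
    (A := fun i => i ≤ p → Consistent χ a s fun l => l < i ∧ InCode m c l) ?_ ?_ ?_ p le_rfl
  · refine (hn.and ((DefBdd.lt (.const p) (.var 0)).not.sigma _)
      (hM.defSigma_not_consistent (a := a) (s := s) hk hχ ((DefBdd.lt (.var 0) (.var 1)).and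
        (hM.defBdd_inCode (.const m) (.const c) (.var 0))))).congr fun e => ?_
    simp only [cons, Classical.not_imp, not_lt]
  · intro _ x hx
    obtain ⟨y, hy, hxy⟩ := h x hx
    exact ⟨y, hy, hxy, fun b _ hb => not_lt_zero hb.1⟩
  · intro i ih hi
    have hip : i < p := (lt_add_one i).trans_le hi
    by_cases hic : InCode m c i
    · refine Consistent.mono ((hc i hip).1 hic) fun l hl => ?_
      exact (hM.le_of_lt_succ hl.1).lt_or_eq.imp_left fun h => ⟨h, hl.2⟩
    · refine (ih hip.le).mono fun l hl => ⟨(hM.le_of_lt_succ hl.1).lt_of_ne ?_, hl.2⟩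
      rintro rfl
      exact hic hl.2

theorem CollModel.isGreedy_unique (hM : CollModel M k) {m c p m' c' p' : M}
    (hc : IsGreedy χ a s m c p) (hc' : IsGreedy χ a s m' c' p') {i : M} (hi : i < p)
    (hi' : i < p') : InCode m c i ↔ InCode m' c' i := by
  have key : ∀ x, ∀ i, i < x → i < p → i < p' → (InCode m c i ↔ InCode m' c' i) :=
    fun x => hM.ind (fun e => ∀ i, i < e 0 → i < p → i < p' → (InCode m c i ↔ InCode m' c' i))
      (DefBdd.ball (.var 0) ((DefBdd.lt (.var 0) (.const p)).imp
        ((DefBdd.lt (.var 0) (.const p')).imp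
          ((hM.defBdd_inCode (.const m) (.const c) (.var 0)).iff
            (hM.defBdd_inCode (.const m') (.const c') (.var 0)))))) (fun _ => 0)
      (fun i hi => absurd hi not_lt_zero)
      (fun x ih i hix hi hi' => by
        rw [hc i hi, hc' i hi']
        refine Extends.congr fun l hl => ih l (hl.trans_le (hM.le_of_lt_succ hix)) ?_ ?_
        exacts [hl.trans hi, hl.trans hi']) x
  exact key (i + 1) i (lt_add_one i) hi hi'

theorem CollModel.exists_isGreedy (hM : CollModel M k) (hk : n + 2 ≤ k)
    (hχ : DefSigma (n + 1) fun e => ¬ χ (e 1) (e 0)) (p : M) : ∃ m c, IsGreedy χ a s m c p := by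
  obtain ⟨m, w, hcode⟩ := hM.exists_code (by omega) p
  suffices ∀ x, x ≤ p → ∃ c, c < w + 1 ∧ IsGreedy χ a s m c x by
    obtain ⟨c, -, hc⟩ := this p le_rfl
    exact ⟨m, c, hc⟩
  refine hM.induction_of_local (fun _ => ?_) ?_ ?_
  · obtain ⟨Q, hQ, h⟩ := hM.exists_defBdd_inBox hk 2 (max p (w + 1))
      (hM.defSigma_not_extends (a := a) (s := s) hk hχ (.const m) (.var 1) (.var 0))
    let σ : ℕ → (ℕ → M) → M := fun i => match i with
      | 0 => fun e => e 0
      | 1 => fun e => e 1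
      | _ + 2 => fun _ => 0
    have hσ : ∀ i, IsPoly (σ i)
      | 0 => .var 0
      | 1 => .var 1
      | _ + 2 => .const 0
    have hσe : ∀ i c e, (fun j => σ j (cons i (cons c e))) = cons i (cons c fun _ => 0) := by
      intro i c e
      funext j
      match j with
      | 0 => rfl
      | 1 => rfl
      | j + 2 => rfl
    refine ⟨_, (DefBdd.lt (.const p) (.var 0)).not.imp (DefBdd.bex (.const (w + 1))
      (DefBdd.ball (.var 1) ((hM.defBdd_inCode (.const m) (.var 1) (.var 0)).iff
        (hQ.subst hσ).not))), fun x _ => ?_⟩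
    simp only [hσe, cons, not_lt]
    refine imp_congr_right fun hx => exists_congr fun c => and_congr_right fun hc => ?_
    refine forall_congr' fun i => imp_congr_right fun hi => ?_
    rw [← h (cons i (cons c fun _ => 0)) (inBox_cons.2 ⟨lt_max_of_lt_left (hi.trans_le hx),
      inBox_cons.2 ⟨lt_max_of_lt_right hc, fun i hi => by omega, fun _ _ => rfl⟩⟩), not_not]
    rfl
  · exact fun _ => ⟨0, by positivity, fun i hi => absurd hi not_lt_zero⟩
  · intro x ih hx
    have hxp : x < p := (lt_add_one x).trans_le hx
    obtain ⟨c, -, hc⟩ := ih hxp.le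
    obtain ⟨c', hc'w, hc'⟩ := hcode
      (fun l => (l < x ∧ InCode m c l) ∨ (l = x ∧ Extends χ a s m c x))
      (((DefBdd.lt (.var 0) (.const x)).and
        (hM.defBdd_inCode (.const m) (.const c) (.var 0))).or
        ((DefBdd.eq (.var 0) (.const x)).and (.prop _)))
    have hcc' : ∀ l, l < x → (InCode m c l ↔ InCode m c' l) := fun l hl => by
      rw [hc' l (hl.trans hxp)]
      simp [hl, hl.ne]
    refine ⟨c', hc'w.trans_lt (lt_add_one w), fun i hi => ?_⟩
    rcases (hM.le_of_lt_succ hi).lt_or_eq with hlt | rfl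
    · rw [← hcc' i hlt, hc i hlt]
      exact Extends.congr fun l hl => hcc' l (hl.trans hlt)
    · rw [hc' i hxp, ← Extends.congr hcc']
      simp

theorem CollModel.eq_of_mul_add_eq (hM : CollModel M k) {b b' y y' : M} (hy : y < a)
    (hy' : y' < a) (h : b * a + y = b' * a + y') : b = b' ∧ y = y' := by
  have key : ∀ {b b' y y' : M}, y < a → b * a + y = b' * a + y' → ¬ b < b' := by
    intro b b' y y' hy h hlt
    refine h.not_lt ?_
    calc b * a + y < b * a + a := by gcongr
      _ = (b + 1) * a := by ring
      _ ≤ b' * a := by gcongr; exact hM.succ_le b b' hlt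
      _ ≤ b' * a + y' := le_self_add
  obtain rfl : b = b' := le_antisymm (not_lt.1 (key hy' h.symm)) (not_lt.1 (key hy h))
  exact ⟨rfl, add_left_cancel h⟩

theorem CollModel.weakRegularity_pi (hM : CollModel M (n + 2))
    (hχ : DefSigma (n + 1) fun e => ¬ χ (e 1) (e 0)) (h : ∀ x, s < x → ∃ y, y < a ∧ χ x y) :
    ∃ y, y < a ∧ ∀ b, ∃ x, b < x ∧ χ x y := by
  have hn := hM.bddClosed (j := n + 2) le_rfl
  by_cases hall : ∀ y, y < a → ∃ p m c b, IsGreedy χ a s m c p ∧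
      b * a + y < p ∧ InCode m c (b * a + y)
  · have hpoly : IsPoly fun e : ℕ → M => e 0 * a + e 4 :=
      ((IsPoly.var 0).mul (.const a)).add (.var 4)
    obtain ⟨p, hp⟩ := hM.coll (fun e => ∃ m c b, IsGreedy χ a s m c (e 0) ∧
        b * a + e 1 < e 0 ∧ InCode m c (b * a + e 1))
      (hM.ex le_rfl (hM.ex le_rfl (hM.ex le_rfl (P := fun e => IsGreedy χ a s (e 2) (e 1) (e 3) ∧
        e 0 * a + e 4 < e 3 ∧ InCode (e 2) (e 1) (e 0 * a + e 4))
        (hn.and (hM.defSigma_isGreedy le_rfl hχ (.var 2) (.var 1) (.var 3))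
          (((DefBdd.lt hpoly (.var 3)).and
            (hM.defBdd_inCode (.var 2) (.var 1) hpoly)).sigma _))))) a (fun _ => 0) hall
    obtain ⟨m, c, hc⟩ := hM.exists_isGreedy (a := a) (s := s) le_rfl hχ p
    obtain ⟨x, hsx, hpx⟩ := exists_gt_both s p
    obtain ⟨y, hya, -, hy⟩ := hM.consistent_of_isGreedy le_rfl hχ h hc x hsx
    obtain ⟨q, hqp, m', c', b, hc', hbq, hby⟩ := hp y hya
    have hbp : b * a + y < p := lt_trans hbq hqp
    refine absurd ⟨hbp, (hM.isGreedy_unique hc' hc hbq hbp).1 hby⟩ (hy b (lt_trans ?_ hpx))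
    refine lt_of_le_of_lt ?_ hbp
    have ha : 1 ≤ a := by simpa using hM.succ_le 0 a (pos_of_gt hya)
    exact (le_mul_of_one_le_right zero_le ha).trans le_self_add
  · push Not at hall
    obtain ⟨y, hya, hy⟩ := hall
    refine ⟨y, hya, fun b => ?_⟩
    obtain ⟨m, c, hc⟩ := hM.exists_isGreedy (a := a) (s := s) le_rfl hχ (b * a + y + 1)
    have hnot := mt (hc _ (lt_add_one _)).2 (hy _ m c b hc (lt_add_one _))
    have hc₀ : IsGreedy χ a s m c (b * a + y) := fun i hi => hc i (hi.trans (lt_add_one _))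
    simp only [Extends, Consistent] at hnot
    push Not at hnot
    obtain ⟨x, hsx, hx⟩ := hnot
    obtain ⟨y', hy', hxy', hb'⟩ := hM.consistent_of_isGreedy le_rfl hχ h hc₀ x hsx
    obtain ⟨b', hb'x, hF | hF⟩ := hx y' hy' hxy'
    · exact absurd hF (hb' b' hb'x)
    · obtain ⟨rfl, rfl⟩ := hM.eq_of_mul_add_eq hy' hya hF
      exact ⟨x, hb'x, hxy'⟩

theorem CollModel.weakRegularity (hM : CollModel M (n + 2)) {ψ : M → M → Prop}
    (hψ : DefSigma (n + 1) fun e => ψ (e 1) (e 0))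
    (hχ : DefSigma (n + 1) fun e => ¬ χ (e 1) (e 0))
    (h : ∀ x, ∃ y, y < a ∧ (ψ x y ∨ χ x y)) :
    ∃ y, y < a ∧ ∀ b, ∃ x, b < x ∧ (ψ x y ∨ χ x y) := by
  by_cases hall : ∀ y, y < a → ∃ b, ¬ ∃ x, b < x ∧ ψ x y
  · have hn := hM.bddClosed (j := n + 1) (by omega)
    let σ : ℕ → (ℕ → M) → M := fun i => match i with
      | 0 => fun e => e 2
      | 1 => fun e => e 0
      | i + 2 => fun e => e (i + 3)
    have hσ : ∀ i, IsPoly (σ i)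
      | 0 => .var 2
      | 1 => .var 0
      | i + 2 => .var (i + 3)
    have hdef : DefSigma (n + 1) fun e => ∃ x, e 0 < x ∧ ψ x (e 1) :=
      hM.ex (by omega) (hn.and ((DefBdd.lt (.var 1) (.var 0)).sigma _) (hψ.subst hσ))
    obtain ⟨s, hs⟩ := hM.coll (fun e => ¬ ∃ x, e 0 < x ∧ ψ x (e 1))
      (DefSigma.of_pi (by simpa only [not_not] using hdef)) a (fun _ => 0) hall
    obtain ⟨y, hya, hy⟩ := hM.weakRegularity_pi (s := s) hχ fun x hsx => by
      obtain ⟨y, hya, hxy | hxy⟩ := h x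
      · obtain ⟨b, hbs, hb⟩ := hs y hya
        exact absurd ⟨x, hbs.trans hsx, hxy⟩ hb
      · exact ⟨y, hya, hxy⟩
    exact ⟨y, hya, fun b => (hy b).imp fun x hx => ⟨hx.1, Or.inr hx.2⟩⟩
  · push Not at hall
    obtain ⟨y, hya, hy⟩ := hall
    exact ⟨y, hya, fun b => (hy b).imp fun x hx => ⟨hx.1, Or.inl hx.2⟩⟩

end WeakRegularity

end Definability

/-! ## Formulas and definable predicates -/

section Formulas

variable {M : Type}

/-- The substitution `σ` pushed under a quantifier over the variable `x`. -/
def updSubst (σ : ℕ → (ℕ → M) → M) (x : ℕ) : ℕ → (ℕ → M) → M :=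
  upd (fun i e => σ i fun j => e (j + 1)) x fun e => e 0

theorem updSubst_cons (σ : ℕ → (ℕ → M) → M) (x : ℕ) (m : M) (e : ℕ → M) :
    (fun i => updSubst σ x i (cons m e)) = upd (fun i => σ i e) x m := by
  funext i
  simp only [updSubst, upd]
  split_ifs <;> rfl

theorem isPoly_updSubst [Add M] [Mul M] {σ : ℕ → (ℕ → M) → M} (hσ : ∀ i, IsPoly (σ i)) (x i : ℕ) :
    IsPoly (updSubst σ x i) := by
  simp only [updSubst, upd]
  split_ifs
  exacts [.var 0, (hσ i).subst fun j => .var (j + 1)]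

variable (M) [Zero M] [One M] [Add M] [Mul M] [LT M]

/-- The arithmetic structure given by an ordered semiring. -/
abbrev strOf : Str := ⟨M, 0, 1, (· + ·), (· * ·), (· < ·)⟩

variable {M}

theorem isPoly_tval {σ : ℕ → (ℕ → M) → M} (hσ : ∀ i, IsPoly (σ i)) (t : Term) :
    IsPoly fun e => tval (strOf M) (fun i => σ i e) t := by
  induction t with
  | var i => exact hσ i
  | zero => exact .const 0
  | one => exact .const 1
  | add t u ht hu => exact ht.add hu
  | mul t u ht hu => exact ht.mul hu

theorem Delta0.defBdd {φ : Fml} (hφ : Delta0 φ) : ∀ {σ : ℕ → (ℕ → M) → M},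
    (∀ i, IsPoly (σ i)) → DefBdd fun e => Sat0 (strOf M) (fun i => σ i e) φ := by
  induction hφ with
  | eq t u => exact fun hσ => .eq (isPoly_tval hσ t) (isPoly_tval hσ u)
  | lt t u => exact fun hσ => .lt (isPoly_tval hσ t) (isPoly_tval hσ u)
  | not _ ih => exact fun hσ => (ih hσ).not
  | and _ _ ih₁ ih₂ => exact fun hσ => (ih₁ hσ).and (ih₂ hσ)
  | or _ _ ih₁ ih₂ => exact fun hσ => (ih₁ hσ).or (ih₂ hσ)
  | imp _ _ ih₁ ih₂ => exact fun hσ => (ih₁ hσ).imp (ih₂ hσ)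
  | ball x t _ ih =>
    intro σ hσ
    refine (DefBdd.ball (isPoly_tval hσ t) (ih (isPoly_updSubst hσ x))).congr fun e => ?_
    simp only [updSubst_cons]
    rfl
  | bex x t _ ih =>
    intro σ hσ
    refine (DefBdd.bex (isPoly_tval hσ t) (ih (isPoly_updSubst hσ x))).congr fun e => ?_
    simp only [updSubst_cons]
    rfl

end Formulas

section Hierarchy

variable {M : Type} [CommSemiring M] [LinearOrder M] [IsStrictOrderedRing M] {k : ℕ}

mutual

theorem IsSigma.defSigma (hM : CollModel M k) {j : ℕ} {φ : Fml} (hφ : IsSigma j φ) (hj : j ≤ k)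
    {σ : ℕ → (ℕ → M) → M} (hσ : ∀ i, IsPoly (σ i)) :
    DefSigma j fun e => Sat0 (strOf M) (fun i => σ i e) φ := by
  match hφ with
  | .delta0 h => exact (h.defBdd hσ).sigma _
  | .ofPi h => exact DefSigma.of_pi (IsPi.defSigma_not hM h (by omega) hσ)
  | .ex x h =>
    refine (hM.ex hj (IsSigma.defSigma hM h hj (isPoly_updSubst hσ x))).congr fun e => ?_
    simp only [updSubst_cons]
    rfl

theorem IsPi.defSigma_not (hM : CollModel M k) {j : ℕ} {φ : Fml} (hφ : IsPi j φ) (hj : j ≤ k)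
    {σ : ℕ → (ℕ → M) → M} (hσ : ∀ i, IsPoly (σ i)) :
    DefSigma j fun e => ¬ Sat0 (strOf M) (fun i => σ i e) φ := by
  match hφ with
  | .delta0 h => exact (h.defBdd hσ).not.sigma _
  | .ofSigma h =>
    exact DefSigma.of_pi ((IsSigma.defSigma hM h (by omega) hσ).congr fun _ => not_not.symm)
  | .all x h =>
    refine (hM.ex hj (IsPi.defSigma_not hM h hj (isPoly_updSubst hσ x))).congr fun e => ?_
    simp only [updSubst_cons]
    exact not_forall.symm

end

end Hierarchy

section Renaming

/-- Rename the variables of a term. -/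
def Term.rename (ρ : ℕ → ℕ) : Term → Term
  | .var i => .var (ρ i)
  | .zero => .zero
  | .one => .one
  | .add t u => .add (t.rename ρ) (u.rename ρ)
  | .mul t u => .mul (t.rename ρ) (u.rename ρ)

/-- Rename the number variables of a formula, including the bound ones. -/
def Fml.rename (ρ : ℕ → ℕ) : Fml → Fml
  | .eq t u => .eq (t.rename ρ) (u.rename ρ)
  | .lt t u => .lt (t.rename ρ) (u.rename ρ)
  | .mem t i => .mem (t.rename ρ) i
  | .not φ => .not (φ.rename ρ)
  | .and φ ψ => .and (φ.rename ρ) (ψ.rename ρ)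
  | .or φ ψ => .or (φ.rename ρ) (ψ.rename ρ)
  | .imp φ ψ => .imp (φ.rename ρ) (ψ.rename ρ)
  | .all x φ => .all (ρ x) (φ.rename ρ)
  | .ex x φ => .ex (ρ x) (φ.rename ρ)
  | .ball x t φ => .ball (ρ x) (t.rename ρ) (φ.rename ρ)
  | .bex x t φ => .bex (ρ x) (t.rename ρ) (φ.rename ρ)
  | .sall i φ => .sall i (φ.rename ρ)
  | .sex i φ => .sex i (φ.rename ρ)

variable {S : Str} {ρ : ℕ → ℕ}

theorem tval_rename (v : ℕ → S.M) (t : Term) :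
    tval S v (t.rename ρ) = tval S (v ∘ ρ) t := by
  induction t with
  | var | zero | one => rfl
  | add t u ht hu | mul t u ht hu => simp only [Term.rename, tval, ht, hu]

theorem upd_comp {α : Type} (hρ : Function.Injective ρ) (v : ℕ → α) (x : ℕ) (m : α) :
    upd v (ρ x) m ∘ ρ = upd (v ∘ ρ) x m := by
  funext i
  simp [upd, hρ.eq_iff]

theorem sat_rename (hρ : Function.Injective ρ) (X : Set (Set S.M)) (φ : Fml) :
    ∀ (v : ℕ → S.M) (w : ℕ → Set S.M), Sat S X v w (φ.rename ρ) ↔ Sat S X (v ∘ ρ) w φ := by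
  induction φ <;> intro v w <;> simp_all only [Fml.rename, Sat, tval_rename, upd_comp hρ]

theorem sat0_rename (hρ : Function.Injective ρ) (v : ℕ → S.M) (φ : Fml) :
    Sat0 S v (φ.rename ρ) ↔ Sat0 S (v ∘ ρ) φ :=
  sat_rename hρ _ φ v _

theorem Delta0.rename {φ : Fml} (hφ : Delta0 φ) (ρ : ℕ → ℕ) : Delta0 (φ.rename ρ) := by
  induction hφ with
  | eq t u => exact .eq _ _
  | lt t u => exact .lt _ _
  | not _ ih => exact .not ih
  | and _ _ ih₁ ih₂ => exact .and ih₁ ih₂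
  | or _ _ ih₁ ih₂ => exact .or ih₁ ih₂
  | imp _ _ ih₁ ih₂ => exact .imp ih₁ ih₂
  | ball x t _ ih => exact .ball _ _ ih
  | bex x t _ ih => exact .bex _ _ ih

mutual

theorem IsSigma.rename {j : ℕ} {φ : Fml} (hφ : IsSigma j φ) (ρ : ℕ → ℕ) :
    IsSigma j (φ.rename ρ) := by
  match hφ with
  | .delta0 h => exact .delta0 (h.rename ρ)
  | .ofPi h => exact .ofPi (IsPi.rename h ρ)
  | .ex x h => exact .ex _ (IsSigma.rename h ρ)

theorem IsPi.rename {j : ℕ} {φ : Fml} (hφ : IsPi j φ) (ρ : ℕ → ℕ) :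
    IsPi j (φ.rename ρ) := by
  match hφ with
  | .delta0 h => exact .delta0 (h.rename ρ)
  | .ofSigma h => exact .ofSigma (IsSigma.rename h ρ)
  | .all x h => exact .all _ (IsPi.rename h ρ)

end

end Renaming

section Representation

variable {M : Type}

/-- The variable holding the `i`-th argument. -/
def argVar (i : ℕ) : ℕ := Equiv.natSumNatEquivNat (.inl i)

/-- The variable holding the `i`-th parameter. -/
def paramVar (i : ℕ) : ℕ := Equiv.natSumNatEquivNat (.inr i)

/-- The valuation with arguments `e` and parameters `p`. -/
def mix (e p : ℕ → M) : ℕ → M := Sum.elim e p ∘ Equiv.natSumNatEquivNat.symm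

@[simp] theorem mix_argVar (e p : ℕ → M) (i : ℕ) : mix e p (argVar i) = e i := by
  simp [mix, argVar]

@[simp] theorem mix_paramVar (e p : ℕ → M) (i : ℕ) : mix e p (paramVar i) = p i := by
  simp [mix, paramVar]

theorem upd_mix_argVar (e p : ℕ → M) (i : ℕ) (m : M) :
    upd (mix e p) (argVar i) m = mix (upd e i m) p := by
  funext l
  obtain ⟨l, rfl⟩ := Equiv.natSumNatEquivNat.surjective l
  cases l with
  | inl l => simp [mix, upd, argVar]
  | inr l =>
    have h : paramVar l ≠ argVar i := Equiv.natSumNatEquivNat.injective.ne Sum.inr_ne_inl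
    change upd (mix e p) _ m (paramVar l) = mix _ p (paramVar l)
    simp [upd, h]

/-- The renaming of arguments and parameters given by `f`. -/
def sumRename (f : ℕ ⊕ ℕ → ℕ ⊕ ℕ) : ℕ → ℕ :=
  Equiv.natSumNatEquivNat ∘ f ∘ Equiv.natSumNatEquivNat.symm

theorem sumRename_injective {f : ℕ ⊕ ℕ → ℕ ⊕ ℕ} (hf : Function.Injective f) :
    Function.Injective (sumRename f) :=
  Equiv.natSumNatEquivNat.injective.comp (hf.comp (Equiv.injective _))

/-- Move the parameters to the places given by `ι`. -/
def paramRename (ι : ℕ → ℕ) : ℕ → ℕ := sumRename (Sum.map id ι)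

theorem argVar_injective : Function.Injective argVar :=
  Equiv.natSumNatEquivNat.injective.comp Sum.inl_injective

theorem paramVar_injective : Function.Injective paramVar :=
  Equiv.natSumNatEquivNat.injective.comp Sum.inr_injective

theorem paramRename_injective {ι : ℕ → ℕ} (hι : Function.Injective ι) :
    Function.Injective (paramRename ι) :=
  sumRename_injective (Function.injective_id.sumMap hι)

theorem mix_comp_paramRename (e p : ℕ → M) (ι : ℕ → ℕ) :
    mix e p ∘ paramRename ι = mix e (p ∘ ι) := by
  funext l
  obtain ⟨l, rfl⟩ := Equiv.natSumNatEquivNat.surjective l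
  cases l <;> simp [mix, paramRename, sumRename]

theorem mix_comp_argVar (e p : ℕ → M) : mix e p ∘ argVar = e := funext (mix_argVar e p)

theorem mix_comp_paramVar (e p : ℕ → M) : mix e p ∘ paramVar = p := funext (mix_paramVar e p)

/-- Where arguments and parameters go when the first argument gets bound. -/
def bindMap : ℕ ⊕ ℕ → ℕ ⊕ ℕ
  | .inl 0 => .inr (paramVar 0)
  | .inl (i + 1) => .inl i
  | .inr i => .inr (argVar i)

theorem bindMap_injective : Function.Injective bindMap := by
  have h : ∀ i, argVar i ≠ paramVar 0 := fun i =>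
    Equiv.natSumNatEquivNat.injective.ne Sum.inl_ne_inr
  rintro ((_ | i) | i) ((_ | j) | j) hij <;>
    simp_all [bindMap, argVar_injective.eq_iff, (h _).symm]

/-- The bound variable replacing the first argument. -/
def boundVar : ℕ := sumRename bindMap (argVar 0)

theorem mix_comp_bind (e p q : ℕ → M) (m : M) :
    upd (mix e (mix p q)) boundVar m ∘ sumRename bindMap = mix (cons m e) p := by
  rw [boundVar, upd_comp (sumRename_injective bindMap_injective)]
  funext l
  obtain ⟨l, rfl⟩ := Equiv.natSumNatEquivNat.surjective l
  rcases l with (_ | l) | l <;> simp [mix, upd, argVar, sumRename, bindMap, cons]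

variable [Zero M] [One M] [Add M] [Mul M] [LT M]

theorem sat0_bind (e p q : ℕ → M) (m : M) (φ : Fml) :
    Sat0 (strOf M) (upd (mix e (mix p q)) boundVar m) (φ.rename (sumRename bindMap)) ↔
      Sat0 (strOf M) (mix (cons m e) p) φ := by
  rw [sat0_rename (sumRename_injective bindMap_injective), mix_comp_bind]

theorem sat0_paramRename_argVar (e p q : ℕ → M) (φ : Fml) :
    Sat0 (strOf M) (mix e (mix p q)) (φ.rename (paramRename argVar)) ↔
      Sat0 (strOf M) (mix e p) φ := by
  rw [sat0_rename (paramRename_injective argVar_injective), mix_comp_paramRename,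
    mix_comp_argVar]

theorem sat0_paramRename_paramVar (e p q : ℕ → M) (φ : Fml) :
    Sat0 (strOf M) (mix e (mix p q)) (φ.rename (paramRename paramVar)) ↔
      Sat0 (strOf M) (mix e q) φ := by
  rw [sat0_rename (paramRename_injective paramVar_injective), mix_comp_paramRename,
    mix_comp_paramVar]

theorem tval_paramRename_argVar (e p q : ℕ → M) (t : Term) :
    tval (strOf M) (mix e (mix p q)) (t.rename (paramRename argVar)) =
      tval (strOf M) (mix e p) t := by
  rw [tval_rename, mix_comp_paramRename, mix_comp_argVar]

theorem tval_paramRename_paramVar (e p q : ℕ → M) (t : Term) :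
    tval (strOf M) (mix e (mix p q)) (t.rename (paramRename paramVar)) =
      tval (strOf M) (mix e q) t := by
  rw [tval_rename, mix_comp_paramRename, mix_comp_paramVar]

theorem IsPoly.exists_term {s : (ℕ → M) → M} (hs : IsPoly s) :
    ∃ (t : Term) (p : ℕ → M), ∀ e, s e = tval (strOf M) (mix e p) t := by
  induction hs with
  | var i => exact ⟨.var (argVar i), fun _ => 0, fun e => (mix_argVar e _ i).symm⟩
  | const c => exact ⟨.var (paramVar 0), fun _ => c, fun e =>
    (mix_paramVar e (fun _ => c) 0).symm⟩
  | add _ _ h₁ h₂ =>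
    obtain ⟨t, p, ht⟩ := h₁
    obtain ⟨u, q, hu⟩ := h₂
    refine ⟨.add (t.rename (paramRename argVar)) (u.rename (paramRename paramVar)), mix p q,
      fun e => ?_⟩
    simp only [ht, hu, ← tval_paramRename_argVar e p q t, ← tval_paramRename_paramVar e p q u]
    rfl
  | mul _ _ h₁ h₂ =>
    obtain ⟨t, p, ht⟩ := h₁
    obtain ⟨u, q, hu⟩ := h₂
    refine ⟨.mul (t.rename (paramRename argVar)) (u.rename (paramRename paramVar)), mix p q,
      fun e => ?_⟩
    simp only [ht, hu, ← tval_paramRename_argVar e p q t, ← tval_paramRename_paramVar e p q u]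
    rfl

/-- `P` is defined with parameters by a formula from `Γ`. -/
def DefinedIn (Γ : Fml → Prop) (P : (ℕ → M) → Prop) : Prop :=
  ∃ φ, Γ φ ∧ ∃ p : ℕ → M, ∀ e, P e ↔ Sat0 (strOf M) (mix e p) φ

theorem DefinedIn.mono {Γ Δ : Fml → Prop} {P : (ℕ → M) → Prop} (hP : DefinedIn Γ P)
    (h : ∀ φ, Γ φ → Δ φ) : DefinedIn Δ P :=
  let ⟨φ, hφ, hp⟩ := hP
  ⟨φ, h φ hφ, hp⟩

theorem DefinedIn.not {P : (ℕ → M) → Prop} (hP : DefinedIn Delta0 P) :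
    DefinedIn Delta0 fun e => ¬ P e :=
  let ⟨φ, hφ, p, h⟩ := hP
  ⟨.not φ, .not hφ, p, fun e => not_congr (h e)⟩

theorem DefBdd.definedIn {P : (ℕ → M) → Prop} (hP : DefBdd P) : DefinedIn Delta0 P := by
  induction hP with
  | eq hs ht =>
    obtain ⟨t, p, hs⟩ := hs.exists_term
    obtain ⟨u, q, ht⟩ := ht.exists_term
    refine ⟨.eq (t.rename (paramRename argVar)) (u.rename (paramRename paramVar)), .eq _ _,
      mix p q, fun e => ?_⟩
    simp only [hs, ht, ← tval_paramRename_argVar e p q t, ← tval_paramRename_paramVar e p q u]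
    rfl
  | lt hs ht =>
    obtain ⟨t, p, hs⟩ := hs.exists_term
    obtain ⟨u, q, ht⟩ := ht.exists_term
    refine ⟨.lt (t.rename (paramRename argVar)) (u.rename (paramRename paramVar)), .lt _ _,
      mix p q, fun e => ?_⟩
    simp only [hs, ht, ← tval_paramRename_argVar e p q t, ← tval_paramRename_paramVar e p q u]
    rfl
  | not _ ih => exact ih.not
  | and _ _ ih₁ ih₂ =>
    obtain ⟨φ, hφ, p, hp⟩ := ih₁
    obtain ⟨ψ, hψ, q, hq⟩ := ih₂
    refine ⟨.and (φ.rename (paramRename argVar)) (ψ.rename (paramRename paramVar)),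
      .and (hφ.rename _) (hψ.rename _), mix p q, fun e => ?_⟩
    simp only [hp, hq, ← sat0_paramRename_argVar e p q, ← sat0_paramRename_paramVar e p q]
    rfl
  | ball ht _ ih =>
    obtain ⟨t, q, ht⟩ := ht.exists_term
    obtain ⟨φ, hφ, p, hp⟩ := ih
    refine ⟨.ball boundVar (t.rename (paramRename paramVar))
      (φ.rename (sumRename bindMap)), .ball _ _ (hφ.rename _), mix p q, fun e => ?_⟩
    rw [Sat0, Sat, tval_paramRename_paramVar]
    simp only [hp, ht, ← sat0_bind e p q]
    rfl

theorem DefSigma.definedIn {j : ℕ} : ∀ {P : (ℕ → M) → Prop}, DefSigma j P →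
    DefinedIn (IsSigma j) P ∧ DefinedIn (IsPi j) fun e => ¬ P e := by
  induction j with
  | zero =>
    intro P hP
    have h := DefBdd.definedIn hP
    exact ⟨h.mono fun _ => .delta0, h.not.mono fun _ => .delta0⟩
  | succ j ih =>
    rintro P ⟨Q, hQ, h⟩
    obtain ⟨⟨φ, hφ, p, hp⟩, ψ, hψ, q, hq⟩ := ih hQ
    refine ⟨⟨.ex boundVar (ψ.rename (sumRename bindMap)), .ex _ (.ofPi (hψ.rename _)), mix q q,
      fun e => ?_⟩, .all boundVar (φ.rename (sumRename bindMap)),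
      .all _ (.ofSigma (hφ.rename _)), mix p p, fun e => ?_⟩
    · simp only [h, hq, ← sat0_bind e q q]
      rfl
    · simp only [h, not_exists, not_not, hp, ← sat0_bind e p p]
      rfl

end Representation

theorem CollModel.of_schemes {M : Type} [CommSemiring M] [LinearOrder M] {k : ℕ}
    (hs : ∀ a b : M, a < b → a + 1 ≤ b) (hI : IndFor (strOf M) Delta0)
    (hC : CollFor (strOf M) (IsSigma k)) : CollModel M k := by
  have h₀ : ∀ (e : ℕ → M) m m', upd (cons m e) 0 m' = cons m' e := by
    intro e m m'
    funext i
    cases i <;> simp [upd, cons]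
  have h₁ : ∀ (e : ℕ → M) z m m' z',
      upd (upd (cons z (cons m e)) 1 m') 0 z' = cons z' (cons m' e) := by
    intro e z m m' z'
    funext i
    match i with
    | 0 | 1 | i + 2 => simp [upd, cons]
  refine ⟨hs, fun P hP e => ?_, fun P hP a e => ?_⟩
  · obtain ⟨φ, hφ, p, hp⟩ := hP.definedIn
    have := hI φ hφ (mix (cons 0 e) p) (argVar 0)
    simpa only [upd_mix_argVar, h₀, ← hp] using this
  · obtain ⟨φ, hφ, p, hp⟩ := hP.definedIn.1
    have := hC φ hφ (mix (cons 0 (cons 0 e)) p) (argVar 1) (argVar 0)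
      (argVar_injective.ne one_ne_zero) a
    simpa only [upd_mix_argVar, h₁, ← hp] using this

/-- Weak regularity in models of collection given as ordered semirings. -/
theorem CollModel.wrFor {M : Type} [CommSemiring M] [LinearOrder M] [IsStrictOrderedRing M]
    [CanonicallyOrderedAdd M] {n : ℕ} (hM : CollModel M (n + 2)) :
    WRFor (strOf M) (SigmaOrPi (n + 1)) := by
  rintro _ ⟨ψ, χ, hψ, hχ, rfl⟩ v x y hxy a h
  let σ : ℕ → (ℕ → M) → M := upd (upd (fun i _ => v i) x fun e => e 1) y fun e => e 0
  have hσ : ∀ i, IsPoly (σ i) := by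
    intro i
    simp only [σ, upd]
    split_ifs
    exacts [.var 0, .var 1, .const _]
  have hσe : ∀ e : ℕ → M, (fun i => σ i e) = upd (upd v x (e 1)) y (e 0) := by
    intro e
    funext i
    simp only [σ, upd]
    split_ifs <;> rfl
  have hψ' := hψ.defSigma hM (by omega) hσ
  have hχ' := hχ.defSigma_not hM (by omega) hσ
  simp only [hσe] at hψ' hχ'
  exact hM.weakRegularity (ψ := fun X Y => Sat0 (strOf M) (upd (upd v x X) y Y) ψ)
    (χ := fun X Y => Sat0 (strOf M) (upd (upd v x X) y Y) χ) hψ' hχ' h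

/-- The semiring structure of a model of `PA⁻`. -/
abbrev PAminus.commSemiring {S : Str} (h : PAminus S) : CommSemiring S.M where
  zero := S.zero
  one := S.one
  add := S.add
  mul := S.mul
  nsmul := @nsmulRec _ ⟨S.zero⟩ ⟨S.add⟩
  npow := @npowRec _ ⟨S.one⟩ ⟨S.mul⟩
  add_assoc := h.add_assoc
  add_comm := h.add_comm
  zero_add a := (h.add_comm _ _).trans (h.add_zero a)
  add_zero := h.add_zero
  mul_assoc := h.mul_assoc
  mul_comm := h.mul_comm
  one_mul a := (h.mul_comm _ _).trans (h.mul_one a)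
  mul_one := h.mul_one
  zero_mul a := (h.mul_comm _ _).trans (h.mul_zero a)
  mul_zero := h.mul_zero
  left_distrib := h.distrib
  right_distrib a b c :=
    (h.mul_comm _ _).trans ((h.distrib c a b).trans
      (congrArg₂ S.add (h.mul_comm c a) (h.mul_comm c b)))

/-- The linear order of a model of `PA⁻`. -/
noncomputable abbrev PAminus.linearOrder {S : Str} (h : PAminus S) : LinearOrder S.M where
  le a b := a = b ∨ S.lt a b
  lt := S.lt
  le_refl _ := .inl rfl
  le_trans := by
    rintro a b c (rfl | hab) (rfl | hbc)
    exacts [.inl rfl, .inr hbc, .inr hab, .inr (h.lt_trans _ _ _ hab hbc)]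
  lt_iff_le_not_ge a b := by
    refine ⟨fun hab => ⟨.inr hab, ?_⟩, ?_⟩
    · rintro (rfl | hba)
      exacts [h.lt_irrefl _ hab, h.lt_irrefl _ (h.lt_trans _ _ _ hab hba)]
    · rintro ⟨rfl | hab, hn⟩
      exacts [absurd (.inl rfl) hn, hab]
  le_antisymm := by
    rintro a b (rfl | hab) (hba | hba)
    exacts [rfl, rfl, hba.symm, absurd (h.lt_trans _ _ _ hab hba) (h.lt_irrefl _)]
  le_total a b := by
    rcases h.lt_total a b with hab | hab | hab
    exacts [.inl (.inr hab), .inl (.inl hab), .inr (.inr hab)]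
  toDecidableLE := fun _ _ => Classical.propDecidable _

theorem PAminus.isStrictOrderedRing {S : Str} (h : PAminus S) :
    @IsStrictOrderedRing S.M h.commSemiring.toSemiring h.linearOrder.toPartialOrder := by
  let := h.commSemiring
  let := h.linearOrder
  have hadd : ∀ a b c : S.M, a < b → a + c < b + c := h.add_lt_add
  have hmul : ∀ a b c : S.M, a < b → 0 < c → a * c < b * c := h.mul_lt_mul
  have h01 : (0 : S.M) < 1 := h.zero_lt_one
  have hle : ∀ a b c : S.M, a ≤ b → a + c ≤ b + c := by
    intro a b c hab
    rcases hab.eq_or_lt with rfl | hab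
    exacts [le_rfl, (hadd a b c hab).le]
  have hmle : ∀ a b c : S.M, a + c ≤ b + c → a ≤ b := fun a b c habc =>
    not_lt.1 fun hba => (hadd b a c hba).not_ge habc
  exact {
    add_le_add_left := fun a b hab c => hle a b c hab
    le_of_add_le_add_left := fun a b c habc => hmle b c a (by simpa only [_root_.add_comm] using habc)
    zero_le_one := h01.le
    exists_pair_ne := ⟨0, 1, h01.ne⟩
    mul_lt_mul_of_pos_left := fun c hc a b hab => by
      simpa only [_root_.mul_comm] using hmul a b c hab hc
    mul_lt_mul_of_pos_right := fun c hc a b hab => hmul a b c hab hc }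

theorem PAminus.canonicallyOrderedAdd {S : Str} (h : PAminus S) :
    @CanonicallyOrderedAdd S.M ⟨S.add⟩ h.linearOrder.toLE := by
  let := h.commSemiring
  let := h.linearOrder
  have := h.isStrictOrderedRing
  have h0 : ∀ a : S.M, 0 ≤ a := fun a => (h.zero_le a).imp Eq.symm id
  exact {
    exists_add_of_le := fun {a b} hab => by
      rcases hab.eq_or_lt with rfl | hab
      · exact ⟨0, (_root_.add_zero a).symm⟩
      · obtain ⟨c, hc⟩ := h.sub a b hab
        exact ⟨c, hc.symm⟩
    le_self_add := fun a b => le_add_of_nonneg_right (h0 b)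
    le_add_self := fun a b => le_add_of_nonneg_left (h0 b) }

/-- Corollary `cor:B->rpivsigma`.
For each `n ∈ ℕ`, `BΣₙ₊₂ ⊢ WR(Σₙ₊₁ ∨ Πₙ₊₁)`: every model of `BΣₙ₊₂`
satisfies the weak regularity principle `WRφ` for every disjunction `φ` of
a `Σₙ₊₁` formula and a `Πₙ₊₁` formula, with parameters. -/
theorem statement_13 (n : ℕ) (S : Str) (h : BSigma S (n + 2)) :
    WRFor S (SigmaOrPi (n + 1)) := by
  obtain ⟨⟨hP, hI⟩, hC⟩ := h
  let := hP.commSemiring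
  let := hP.linearOrder
  have := hP.isStrictOrderedRing
  have := hP.canonicallyOrderedAdd
  exact (CollModel.of_schemes (M := S.M) (fun a b hab => hP.discrete a b hab) hI hC).wrFor

end PaperArith
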